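/- arXiv:1203.0153 — 12 statements merged into one kernel-verified Lean document; each statement's English description precedes it below -/
import Mathlib

section
/- Let k be a field of characteristic 0 and let a, b, a', b' be nonzero elements of k with a ≠ b and a' ≠ b'. Then the set of kernel vectors of the matrix M_{aba'b'} never has exactly 8 elements; equivalently, the 𝔽₂-dimension of the kernel of M_{aba'b'} is at most 4 and is never equal to 3. -/
/-- The Skorobogatov–Zarhin matrix `M_{aba'b'}`. -/
def SZMatrix {k : Type*} [Field k] (a b a' b' : k) : Fin 4 → Fin 4 → k :=
  ![![1, a * b, a' * b', -(a * a')],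
    ![a * b, 1, a * a', a' * (a' - b')],
    ![a' * b', a * a', 1, a * (a - b)],
    ![-(a * a'), a' * (a' - b'), a * (a - b), 1]]

/-- `ε ∈ 𝔽₂⁴` is a kernel vector of `M_{aba'b'}` if for every row `i` the product of
those entries `M i j` with `ε j = 1` is a square in `k`. -/
def IsKernelVector {k : Type*} [Field k] (a b a' b' : k) (ε : Fin 4 → ZMod 2) : Prop :=
  ∀ i : Fin 4,
    IsSquare (∏ j ∈ Finset.univ.filter (fun j : Fin 4 => ε j = 1), SZMatrix a b a' b' i j)

theorem zmod_two_eq_zero_or_one : ∀ x : ZMod 2, x = 0 ∨ x = 1 := by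
  decide

section SquareKernel

variable {ι k : Type*} [Fintype ι] [Field k]

/-- Vectors `ε` over `𝔽₂` such that the product of the entries of `f` selected by `ε` is a square
are closed under addition. -/
theorem isSquare_prod_filter_add {f : ι → k} (hf : ∀ j, f j ≠ 0) {ε δ : ι → ZMod 2}
    (hε : IsSquare (∏ j with ε j = 1, f j)) (hδ : IsSquare (∏ j with δ j = 1, f j)) :
    IsSquare (∏ j with (ε + δ) j = 1, f j) := by
  have hne (ε : ι → ZMod 2) : ∏ j with ε j = 1, f j ≠ 0 :=
    Finset.prod_ne_zero_iff.mpr fun j _ => hf j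
  have key : IsSquare ((∏ j with (ε + δ) j = 1, f j) *
      ((∏ j with ε j = 1, f j) * ∏ j with δ j = 1, f j)) := by
    simp only [Finset.prod_filter, ← Finset.prod_mul_distrib, Pi.add_apply]
    refine Finset.isSquare_prod _ fun j _ => ?_
    have h2 : (1 + 1 : ZMod 2) = 0 := rfl
    rcases zmod_two_eq_zero_or_one (ε j) with h | h <;>
      rcases zmod_two_eq_zero_or_one (δ j) with h' | h' <;> simp [h, h', h2]
  rw [← mul_div_cancel_right₀ (∏ j with (ε + δ) j = 1, f j) (mul_ne_zero (hne ε) (hne δ))]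
  exact key.div (hε.mul hδ)

/-- The kernel modulo squares of a matrix with nonzero entries. -/
def squareKernel (M : ι → ι → k) (hM : ∀ i j, M i j ≠ 0) : AddSubgroup (ι → ZMod 2) where
  carrier := {ε | ∀ i, IsSquare (∏ j with ε j = 1, M i j)}
  zero_mem' i := by simp
  add_mem' hε hδ i := isSquare_prod_filter_add (hM i) (hε i) (hδ i)
  neg_mem' {ε} hε := by
    have : -ε = ε := by
      ext j
      simp [ZMod.neg_eq_self_mod_two]
    rwa [this]

theorem mem_squareKernel {M : ι → ι → k} {hM : ∀ i j, M i j ≠ 0} {ε : ι → ZMod 2} :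
    ε ∈ squareKernel M hM ↔ ∀ i, IsSquare (∏ j with ε j = 1, M i j) :=
  Iff.rfl

variable [DecidableEq ι]

theorem single_mem_squareKernel {M : ι → ι → k} {hM : ∀ i j, M i j ≠ 0} {i : ι} :
    Pi.single i 1 ∈ squareKernel M hM ↔ ∀ l, IsSquare (M l i) := by
  have : ({j | (Pi.single i 1 : ι → ZMod 2) j = 1} : Finset ι) = {i} := by
    ext j
    by_cases h : j = i <;> simp [h]
  simp [mem_squareKernel, this]

/-- A symmetric matrix with square diagonal entries induces an alternating form with values in
`kˣ / kˣ²`, so its kernel does not have codimension one. -/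
theorem squareKernel_index_ne_two {M : ι → ι → k} (hM : ∀ i j, M i j ≠ 0)
    (hsymm : ∀ i j, M i j = M j i) (hdiag : ∀ i, IsSquare (M i i)) :
    (squareKernel M hM).index ≠ 2 := by
  intro hidx
  obtain ⟨i, hi⟩ : ∃ i, Pi.single i 1 ∉ squareKernel M hM := by
    by_contra! h
    have htop : squareKernel M hM = ⊤ := by
      refine (AddSubgroup.eq_top_iff' _).mpr fun ε => ?_
      rw [← Finset.univ_sum_single ε]
      refine sum_mem fun j _ => ?_
      rcases zmod_two_eq_zero_or_one (ε j) with hj | hj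
      · simp [hj, zero_mem]
      · exact hj ▸ h j
    simp [htop] at hidx
  refine hi (single_mem_squareKernel.mpr fun j => ?_)
  rw [hsymm]
  by_cases hj : Pi.single j 1 ∈ squareKernel M hM
  · exact single_mem_squareKernel.mp hj i
  · have hmem : Pi.single i 1 + Pi.single j 1 ∈ squareKernel M hM :=
      (AddSubgroup.add_mem_iff_of_index_two hidx).mpr (iff_of_false hi hj)
    by_cases hij : i = j
    · exact hij ▸ hdiag i
    · have hset : ({l | (Pi.single i 1 + Pi.single j 1 : ι → ZMod 2) l = 1} : Finset ι)
          = {i, j} := by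
        ext l
        by_cases h₁ : l = i
        · subst h₁
          simp [hij]
        · by_cases h₂ : l = j <;> simp [h₁, h₂, Ne.symm hij]
      have hprod := mem_squareKernel.mp hmem i
      rw [hset, Finset.prod_pair hij] at hprod
      rw [← mul_div_cancel_left₀ (M i j) (hM i i)]
      exact hprod.div (hdiag i)

end SquareKernel

theorem stmt0 {k : Type*} [Field k] [CharZero k] (a b a' b' : k)
    (ha : a ≠ 0) (hb : b ≠ 0) (ha' : a' ≠ 0) (hb' : b' ≠ 0)
    (hab : a ≠ b) (hab' : a' ≠ b') :
    {ε : Fin 4 → ZMod 2 | IsKernelVector a b a' b' ε}.ncard ≠ 8 := by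
  have hM : ∀ i j, SZMatrix a b a' b' i j ≠ 0 := by
    intro i j
    fin_cases i <;> fin_cases j <;>
      simp [SZMatrix, ha, hb, ha', hb', sub_ne_zero.mpr hab, sub_ne_zero.mpr hab']
  have hsymm : ∀ i j, SZMatrix a b a' b' i j = SZMatrix a b a' b' j i := by
    intro i j
    fin_cases i <;> fin_cases j <;> rfl
  have hdiag : ∀ i, IsSquare (SZMatrix a b a' b' i i) := by
    intro i
    fin_cases i <;> exact IsSquare.one
  intro h
  apply squareKernel_index_ne_two hM hsymm hdiag
  have hcard := (squareKernel (SZMatrix a b a' b') hM).card_mul_index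
  have h8 : Nat.card (squareKernel (SZMatrix a b a' b') hM) = 8 := h
  rw [h8, Nat.card_eq_fintype_card, Fintype.card_fun, ZMod.card, Fintype.card_fin] at hcard
  omega
end

section
/- Let a, b, a', b' be nonzero real numbers with a ≠ b and a' ≠ b'. Then the matrix M_{aba'b'} has exactly 4 kernel vectors; i.e., its kernel has 𝔽₂-dimension 2. (Here an element of ℝ is a square iff it is nonnegative.) -/
/-- The sign of a real number, written additively: `1` for negative numbers, `0` otherwise. -/
noncomputable def signBit (x : ℝ) : ZMod 2 := if x < 0 then 1 else 0

theorem signBit_of_neg {x : ℝ} (hx : x < 0) : signBit x = 1 := if_pos hx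

theorem signBit_of_nonneg {x : ℝ} (hx : 0 ≤ x) : signBit x = 0 := if_neg hx.not_gt

theorem signBit_eq_zero_iff {x : ℝ} : signBit x = 0 ↔ 0 ≤ x := by
  simp [signBit]

theorem signBit_neg {x : ℝ} (hx : x ≠ 0) : signBit (-x) = signBit x + 1 := by
  rcases hx.lt_or_gt with h | h
  · rw [signBit_of_neg h, signBit_of_nonneg (by linarith)]; decide
  · rw [signBit_of_nonneg h.le, signBit_of_neg (by linarith)]; decide

theorem signBit_mul {x y : ℝ} (hx : x ≠ 0) (hy : y ≠ 0) :
    signBit (x * y) = signBit x + signBit y := by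
  rcases hx.lt_or_gt with h | h <;> rcases hy.lt_or_gt with h' | h'
  · rw [signBit_of_neg h, signBit_of_neg h', signBit_of_nonneg (mul_pos_of_neg_of_neg h h').le]
    decide
  · rw [signBit_of_neg h, signBit_of_nonneg h'.le, signBit_of_neg (mul_neg_of_neg_of_pos h h')]
    decide
  · rw [signBit_of_nonneg h.le, signBit_of_neg h', signBit_of_neg (mul_neg_of_pos_of_neg h h')]
    decide
  · rw [signBit_of_nonneg h.le, signBit_of_nonneg h'.le, signBit_of_nonneg (mul_pos h h').le]
    decide

theorem signBit_prod {ι : Type*} (s : Finset ι) {f : ι → ℝ} (hf : ∀ j, f j ≠ 0) :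
    signBit (∏ j ∈ s, f j) = ∑ j ∈ s, signBit (f j) := by
  classical
  induction s using Finset.induction_on with
  | empty => simp [signBit_eq_zero_iff]
  | insert j s hj ih =>
    rw [Finset.prod_insert hj, Finset.sum_insert hj,
      signBit_mul (hf j) (Finset.prod_ne_zero_iff.2 fun i _ => hf i), ih]

theorem isSquare_prod_iff_sum_signBit {ι : Type*} (s : Finset ι) {f : ι → ℝ}
    (hf : ∀ j, f j ≠ 0) : IsSquare (∏ j ∈ s, f j) ↔ ∑ j ∈ s, signBit (f j) = 0 := by
  rw [← signBit_prod s hf, signBit_eq_zero_iff, Real.isSquare_iff]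

/-- If `x * y` is negative then `x * (x - y)` is positive. -/
theorem signBit_mul_signBit_mul_sub (x y : ℝ) :
    signBit (x * y) * signBit (x * (x - y)) = 0 := by
  rcases lt_or_ge (x * y) 0 with h | h
  · rw [signBit_of_nonneg (x := x * (x - y)) (by nlinarith [sq_nonneg x]), mul_zero]
  · rw [signBit_of_nonneg h, zero_mul]

/-- The alternating matrix over `𝔽₂` of the signs of the entries of `SZMatrix`. -/
def signMatrix (p q r u v : ZMod 2) : Fin 4 → Fin 4 → ZMod 2 :=
  ![![0, p, q, r + 1],
    ![p, 0, r, u],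
    ![q, r, 0, v],
    ![r + 1, u, v, 0]]

/-- The Pfaffian of `signMatrix p q r u v` is `p * v + q * u`; when it vanishes the rank is `2`,
because one of `r` and `r + 1` is nonzero. -/
theorem card_kernel_signMatrix : ∀ p q r u v : ZMod 2, p * v = 0 → q * u = 0 →
    (Finset.univ.filter fun ε : Fin 4 → ZMod 2 => ∀ i : Fin 4,
      ∑ j ∈ Finset.univ.filter (fun j : Fin 4 => ε j = 1), signMatrix p q r u v i j = 0).card
      = 4 := by
  decide +kernel

theorem SZMatrix_ne_zero {k : Type*} [Field k] {a b a' b' : k}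
    (ha : a ≠ 0) (hb : b ≠ 0) (ha' : a' ≠ 0) (hb' : b' ≠ 0)
    (hab : a ≠ b) (hab' : a' ≠ b') (i j : Fin 4) : SZMatrix a b a' b' i j ≠ 0 := by
  have h := sub_ne_zero.2 hab
  have h' := sub_ne_zero.2 hab'
  fin_cases i <;> fin_cases j <;> simp [SZMatrix, ha, hb, ha', hb', h, h']

theorem signBit_SZMatrix {a a' : ℝ} (b b' : ℝ) (ha : a ≠ 0) (ha' : a' ≠ 0) (i j : Fin 4) :
    signBit (SZMatrix a b a' b' i j) =
      signMatrix (signBit (a * b)) (signBit (a' * b')) (signBit (a * a'))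
        (signBit (a' * (a' - b'))) (signBit (a * (a - b))) i j := by
  have h1 : signBit 1 = 0 := signBit_of_nonneg zero_le_one
  have hneg := signBit_neg (mul_ne_zero ha ha')
  fin_cases i <;> fin_cases j <;> simp [SZMatrix, signMatrix, h1, hneg]

theorem stmt3 (a b a' b' : ℝ)
    (ha : a ≠ 0) (hb : b ≠ 0) (ha' : a' ≠ 0) (hb' : b' ≠ 0)
    (hab : a ≠ b) (hab' : a' ≠ b') :
    {ε : Fin 4 → ZMod 2 | IsKernelVector a b a' b' ε}.ncard = 4 := by
  refine Eq.trans ?_ (card_kernel_signMatrix _ _ (signBit (a * a')) _ _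
    (signBit_mul_signBit_mul_sub a b) (signBit_mul_signBit_mul_sub a' b'))
  rw [← Set.ncard_coe_finset]
  congr 1
  ext ε
  simp only [Set.mem_ofPred_eq, Finset.coe_filter, Finset.mem_univ, true_and, IsKernelVector]
  refine forall_congr' fun i => ?_
  rw [isSquare_prod_iff_sum_signBit _ (SZMatrix_ne_zero ha hb ha' hb' hab hab' i)]
  simp only [signBit_SZMatrix b b' ha ha']
end

section
/- Let a, b, a', b' be real numbers with a > b > 0 and a' > b' > 0, and let (x, u, z) ∈ ℝ³ satisfy z² = x(x−a)(x−b)·u(u−a')(u−b') and z ≠ 0. Then it is not the case that both (x−a)(x−b) < 0 and u(u−b') < 0, and it is not the case that both x(x−b) < 0 and (u−a')(u−b') < 0. (Consequently the real Hilbert symbols ((x−a)(x−b), u(u−b'))_ℝ and (x(x−b), (u−a')(u−b'))_ℝ are trivial at every real point of the Kummer surface with z ≠ 0.) -/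
/-- If `p < q` and `(t - p) * (t - q) < 0`, then `t` lies strictly between `p` and `q`. -/
theorem mem_Ioo_of_sub_mul_sub_neg {p q t : ℝ} (hpq : p < q) (h : (t - p) * (t - q) < 0) :
    t ∈ Set.Ioo p q := by
  rcases mul_neg_iff.mp h with ⟨h₁, h₂⟩ | ⟨h₁, h₂⟩
  · exact ⟨by linarith, by linarith⟩
  · linarith

theorem stmt4 (a b a' b' x u z : ℝ)
    (hab : a > b) (hb : b > 0) (hab' : a' > b') (hb' : b' > 0)
    (hz : z ≠ 0)
    (heq : z ^ 2 = x * (x - a) * (x - b) * (u * (u - a') * (u - b'))) :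
    ¬((x - a) * (x - b) < 0 ∧ u * (u - b') < 0) ∧
    ¬(x * (x - b) < 0 ∧ (u - a') * (u - b') < 0) := by
  have hpos : 0 < z ^ 2 := by positivity
  constructor
  · rintro ⟨h₁, h₂⟩
    have hx := mem_Ioo_of_sub_mul_sub_neg (t := x) hab (by linarith)
    have hu := mem_Ioo_of_sub_mul_sub_neg (t := u) hb' (by linarith)
    have hneg : x * (u - a') < 0 :=
      mul_neg_of_pos_of_neg (by linarith [hx.1]) (by linarith [hu.2])
    linarith [mul_neg_of_pos_of_neg (mul_pos_of_neg_of_neg h₁ h₂) hneg]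
  · rintro ⟨h₁, h₂⟩
    have hx := mem_Ioo_of_sub_mul_sub_neg (t := x) hb (by linarith)
    have hu := mem_Ioo_of_sub_mul_sub_neg (t := u) hab' (by linarith)
    have hneg : (x - a) * u < 0 :=
      mul_neg_of_neg_of_pos (by linarith [hx.2]) (by linarith [hu.1])
    linarith [mul_neg_of_pos_of_neg (mul_pos_of_neg_of_neg h₁ h₂) hneg]
end

section
/- Let p be a prime number and let a, b, a', b' be nonzero elements of ℚ_p with a ≠ b and a' ≠ b'. Suppose ν_p(a) ≤ ν_p(b), ν_p(a') ≤ ν_p(b'), and the matrix M_{aba'b'} has a nonzero kernel vector. Then ν_p(aa') = ν_p(a) + ν_p(a') is even. -/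
namespace Padic

variable {p : ℕ} [Fact p.Prime]

theorem even_valuation_of_isSquare {x : ℚ_[p]} (hx : x ≠ 0) (h : IsSquare x) :
    Even x.valuation := by
  obtain ⟨r, rfl⟩ := h
  have hr : r ≠ 0 := left_ne_zero_of_mul hx
  exact ⟨r.valuation, valuation_mul hr hr⟩

theorem valuation_neg_eq (x : ℚ_[p]) : (-x).valuation = x.valuation := by
  rcases eq_or_ne x 0 with rfl | hx
  · simp
  · have h1 : (-1 : ℚ_[p]).valuation = 0 := by
      have h := valuation_mul (p := p) (x := -1) (y := -1) (by simp) (by simp)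
      simp only [mul_neg, mul_one, neg_neg, valuation_one] at h
      omega
    rw [neg_eq_neg_one_mul, valuation_mul (by simp) hx, h1, zero_add]

theorem valuation_sub_eq_of_lt {x y : ℚ_[p]} (hx : x ≠ 0) (hxy : x ≠ y)
    (h : x.valuation < y.valuation) : (x - y).valuation = x.valuation := by
  have h1 := le_valuation_add (x := x) (y := -y) (by rwa [← sub_eq_add_neg, sub_ne_zero])
  have h2 := le_valuation_add (x := x - y) (y := y) (by simpa using hx)
  rw [valuation_neg_eq, ← sub_eq_add_neg] at h1
  rw [sub_add_cancel] at h2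
  omega

theorem valuation_prod {ι : Type*} (s : Finset ι) (f : ι → ℚ_[p]) (hf : ∀ i ∈ s, f i ≠ 0) :
    (∏ i ∈ s, f i).valuation = ∑ i ∈ s, (f i).valuation := by
  classical
  induction s using Finset.induction_on with
  | empty => simp
  | insert i s hi ih =>
    have hs : ∀ j ∈ s, f j ≠ 0 := fun j hj => hf j (Finset.mem_insert_of_mem hj)
    rw [Finset.prod_insert hi, Finset.sum_insert hi,
      valuation_mul (hf i (Finset.mem_insert_self i s)) (Finset.prod_ne_zero_iff.2 hs), ih hs]

end Padic

theorem stmt5 (p : ℕ) [Fact p.Prime] (a b a' b' : ℚ_[p])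
    (ha : a ≠ 0) (hb : b ≠ 0) (ha' : a' ≠ 0) (hb' : b' ≠ 0)
    (hab : a ≠ b) (hab' : a' ≠ b')
    (hv : a.valuation ≤ b.valuation) (hv' : a'.valuation ≤ b'.valuation)
    (hker : ∃ ε : Fin 4 → ZMod 2, ε ≠ 0 ∧ IsKernelVector a b a' b' ε) :
    (a * a').valuation = a.valuation + a'.valuation ∧
    Even (a.valuation + a'.valuation) := by
  have hvaa := Padic.valuation_mul ha ha'
  refine ⟨hvaa, ?_⟩
  obtain ⟨ε, hε, hk⟩ := hker
  have hne := SZMatrix_ne_zero ha hb ha' hb' hab hab'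
  have hsum (i : Fin 4) :
      Even (∑ j, if ε j = 1 then (SZMatrix a b a' b' i j).valuation else 0) := by
    rw [← Finset.sum_filter, ← Padic.valuation_prod _ _ fun j _ => hne i j]
    exact Padic.even_valuation_of_isSquare (Finset.prod_ne_zero_iff.2 fun j _ => hne i j) (hk i)
  have h0 := hsum 0
  have h1 := hsum 1
  have h2 := hsum 2
  have h3 := hsum 3
  have hex : ε 0 = 1 ∨ ε 1 = 1 ∨ ε 2 = 1 ∨ ε 3 = 1 := by
    obtain ⟨j, hj⟩ := Function.ne_iff.1 hε
    have hj1 : ε j = 1 := by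
      rw [Pi.zero_apply] at hj
      generalize ε j = t at hj
      revert t
      decide
    fin_cases j <;> simp_all
  have hc : a.valuation < b.valuation → (a - b).valuation = a.valuation :=
    Padic.valuation_sub_eq_of_lt ha hab
  have hc' : a'.valuation < b'.valuation → (a' - b').valuation = a'.valuation :=
    Padic.valuation_sub_eq_of_lt ha' hab'
  simp only [Fin.sum_univ_four, SZMatrix, Matrix.cons_val, Padic.valuation_one,
    Padic.valuation_neg_eq, Padic.valuation_mul ha hb, Padic.valuation_mul ha' hb', hvaa,
    Padic.valuation_mul ha (sub_ne_zero.2 hab), Padic.valuation_mul ha' (sub_ne_zero.2 hab'),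
    Int.even_iff] at h0 h1 h2 h3 ⊢
  split_ifs at h0 h1 h2 h3 <;> first | omega | simp_all
end

section
/- Let p > 2 be a prime and let a, b, a', b' be nonzero elements of ℤ_p ⊆ ℚ_p with a ≠ b and a' ≠ b'. Assume ab, a'b' and −aa' are squares in ℚ_p. Assume moreover that ν_p(a−b) ≥ 1 and ν_p(a) = 0, or that ν_p(a'−b') ≥ 1 and ν_p(a') = 0 (i.e., a ≡ b ≢ 0 (mod p) or a' ≡ b' ≢ 0 (mod p)). Then for all x, u, z ∈ ℚ_p with z ≠ 0 and z² = x(x−a)(x−b)·u(u−a')(u−b'), the Hilbert symbol ((x−a)(x−b), (u−a')(u−b'))_{ℚ_p} is trivial; i.e., there exist r, s ∈ ℚ_p with (x−a)(x−b)·r² + (u−a')(u−b')·s² = 1. -/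
/-- The Hilbert symbol `(A,B)_k` is trivial if `A·r² + B·s² = 1` is solvable. -/
def HilbertTrivial {k : Type*} [Field k] (A B : k) : Prop :=
  ∃ r s : k, A * r ^ 2 + B * s ^ 2 = 1

/-- For `p` odd, two `p`-adic numbers that are close enough lie in the same square class. -/
theorem Padic.exists_eq_mul_sq_of_norm_sub_lt (p : ℕ) [Fact p.Prime] (hp : 2 < p) {c d : ℚ_[p]}
    (h : ‖c - d‖ < ‖d‖) : ∃ e : ℚ_[p], c = d * e ^ 2 := by
  have hd : d ≠ 0 := by
    rintro rfl
    simpa using (norm_nonneg _).trans_lt h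
  have hy : ‖c / d - 1‖ < 1 := by
    rw [div_sub_one hd, norm_div]
    exact (div_lt_one (norm_pos_iff.mpr hd)).mpr h
  have hy1 : ‖c / d‖ ≤ 1 := by
    have := Padic.nonarchimedean (c / d - 1) 1
    rw [sub_add_cancel, norm_one] at this
    exact this.trans (max_le hy.le le_rfl)
  have h2 : ‖(2 : ℤ_[p])‖ = 1 := by
    have := (PadicInt.norm_natCast_eq_one_iff (p := p) (n := 2)).mpr
      ((Nat.coprime_primes Fact.out Nat.prime_two).mpr hp.ne')
    simpa using this
  let y : ℤ_[p] := ⟨c / d, hy1⟩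
  have hnorm : ‖(Polynomial.X ^ 2 - Polynomial.C y : Polynomial ℤ_[p]).aeval (1 : ℤ_[p])‖ <
      ‖(Polynomial.X ^ 2 - Polynomial.C y : Polynomial ℤ_[p]).derivative.aeval (1 : ℤ_[p])‖ ^ 2 := by
    have : ‖(1 : ℤ_[p]) - y‖ < 1 := by
      rw [norm_sub_rev]
      exact hy
    simpa [one_add_one_eq_two, h2] using this
  obtain ⟨e, he, -⟩ := hensels_lemma hnorm
  have he' : e ^ 2 = y := by simpa [sub_eq_zero] using he
  refine ⟨e, ?_⟩
  have : (e : ℚ_[p]) ^ 2 = c / d := by exact_mod_cast congrArg Subtype.val he'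
  rw [this, mul_div_cancel₀ _ hd]

theorem HilbertTrivial.symm {k : Type*} [Field k] {A B : k} (h : HilbertTrivial A B) :
    HilbertTrivial B A := by
  obtain ⟨r, s, h⟩ := h
  exact ⟨s, r, by rw [add_comm, h]⟩

/-- The algebra `((x - a)(x - b), (u - a')(u - b'))` is split when `x` is in the square class
of `a`: the second entry is then a norm from `k(√(a'u))`. -/
theorem HilbertTrivial.of_eq_mul_sq {k : Type*} [Field k] {a b a' b' x u z e : k} (ha' : a' ≠ 0)
    (hsq2 : IsSquare (a' * b')) (hsq3 : IsSquare (-(a * a'))) (hz : z ≠ 0)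
    (h : z ^ 2 = x * (x - a) * (x - b) * (u * (u - a') * (u - b'))) (hx : x = a * e ^ 2) :
    HilbertTrivial ((x - a) * (x - b)) ((u - a') * (u - b')) := by
  obtain ⟨n, hn⟩ := hsq2
  obtain ⟨m, hm⟩ := hsq3
  have hz2 : z ^ 2 ≠ 0 := pow_ne_zero 2 hz
  generalize hA : (x - a) * (x - b) = A
  generalize hB : (u - a') * (u - b') = B
  have h' : z ^ 2 = x * A * (u * B) := by rw [h, ← hA, ← hB]; ring
  have hB0 : B ≠ 0 := by rintro rfl; simp_all
  obtain ⟨w, rfl⟩ : ∃ w, u = w * a' := ⟨u / a', (div_mul_cancel₀ u ha').symm⟩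
  have hnorm : B = (n + w * a') ^ 2 - w * (a' + n) ^ 2 := by
    rw [← hB]
    linear_combination (1 - w) * hn
  have hz' : z ^ 2 = -(w * B * (m * e) ^ 2 * A) := by
    rw [h', hx]
    linear_combination -(w * B * e ^ 2 * A) * hm
  refine ⟨m * e * w * (a' + n) / z, (n + w * a') / B, ?_⟩
  have hA' : A * (m * e * w * (a' + n) / z) ^ 2 = -(w * (a' + n) ^ 2) / B := by
    rw [div_pow, mul_div_assoc', div_eq_div_iff hz2 hB0, hz']
    ring
  rw [hA', div_pow, mul_div_assoc', pow_two B, mul_div_mul_left _ _ hB0, ← add_div,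
    div_eq_one_iff_eq hB0]
  linear_combination -hnorm

theorem HilbertTrivial.of_norm_sub_lt (p : ℕ) [Fact p.Prime] (hp : 2 < p) {a b a' b' x u z : ℚ_[p]}
    (ha' : a' ≠ 0) (hsq2 : IsSquare (a' * b')) (hsq3 : IsSquare (-(a * a')))
    (hab : ‖a - b‖ < ‖a‖) (hz : z ≠ 0)
    (h : z ^ 2 = x * (x - a) * (x - b) * (u * (u - a') * (u - b'))) :
    HilbertTrivial ((x - a) * (x - b)) ((u - a') * (u - b')) := by
  by_cases hxa : ‖x - a‖ < ‖a‖
  · obtain ⟨e, he⟩ := Padic.exists_eq_mul_sq_of_norm_sub_lt p hp hxa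
    exact .of_eq_mul_sq ha' hsq2 hsq3 hz h he
  · have hxb : ‖(x - b) - (x - a)‖ < ‖x - a‖ := by
      rw [sub_sub_sub_cancel_left]
      exact hab.trans_le (not_lt.mp hxa)
    obtain ⟨e, he⟩ := Padic.exists_eq_mul_sq_of_norm_sub_lt p hp hxb
    have hA : (x - a) * (x - b) = ((x - a) * e) ^ 2 := by rw [he]; ring
    have hne : (x - a) * e ≠ 0 := by
      intro h0
      have h1 : (x - a) * (x - b) = 0 := by rw [hA, h0]; ring
      exact pow_ne_zero 2 hz (by rw [h, mul_assoc x, h1]; ring)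
    exact ⟨((x - a) * e)⁻¹, 0, by rw [hA, ← mul_pow, mul_inv_cancel₀ hne]; ring⟩

theorem Padic.norm_sub_lt_of_valuation (p : ℕ) [Fact p.Prime] {a b : ℚ_[p]} (ha : a ≠ 0)
    (hab : a ≠ b) (h : 1 ≤ (a - b).valuation ∧ a.valuation = 0) : ‖a - b‖ < ‖a‖ := by
  rw [Padic.norm_eq_zpow_neg_valuation ha, Padic.norm_eq_zpow_neg_valuation (sub_ne_zero.mpr hab)]
  exact zpow_lt_zpow_right₀ (mod_cast (Fact.out : p.Prime).one_lt) (by omega)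

theorem stmt6 (p : ℕ) [Fact p.Prime] (hp : 2 < p) (a b a' b' : ℚ_[p])
    (ha : a ≠ 0) (hb : b ≠ 0) (ha' : a' ≠ 0) (hb' : b' ≠ 0)
    (haZ : 0 ≤ a.valuation) (hbZ : 0 ≤ b.valuation)
    (haZ' : 0 ≤ a'.valuation) (hbZ' : 0 ≤ b'.valuation)
    (hab : a ≠ b) (hab' : a' ≠ b')
    (hsq1 : IsSquare (a * b)) (hsq2 : IsSquare (a' * b')) (hsq3 : IsSquare (-(a * a')))
    (hcase : (1 ≤ (a - b).valuation ∧ a.valuation = 0) ∨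
             (1 ≤ (a' - b').valuation ∧ a'.valuation = 0)) :
    ∀ x u z : ℚ_[p], z ≠ 0 → z ^ 2 = x * (x - a) * (x - b) * (u * (u - a') * (u - b')) →
      HilbertTrivial ((x - a) * (x - b)) ((u - a') * (u - b')) := by
  intro x u z hz h
  rcases hcase with hc | hc
  · exact .of_norm_sub_lt p hp ha' hsq2 hsq3 (Padic.norm_sub_lt_of_valuation p ha hab hc) hz h
  · exact (HilbertTrivial.of_norm_sub_lt p hp ha hsq1 (by rwa [mul_comm a' a])
      (Padic.norm_sub_lt_of_valuation p ha' hab' hc) hz (h.trans (mul_comm _ _))).symm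
end

section
/- Let p > 2 be a prime, let A, B be nonzero elements of ℚ_p, and let Q be a nonzero square in ℚ_p. Suppose there exist nonzero v, w ∈ ℚ_p with (1 − A·v²)(1 − B·w²) = 1 − Q. Then the Hilbert symbol (A,B)_{ℚ_p} is trivial; i.e., there exist r, s ∈ ℚ_p with A·r² + B·s² = 1. -/
/-- If `a + b - ab = q²` with `a = A v²`, `b = B w²` and `q + a ≠ 0`, the norm identity
`b (1 - a)² + a (1 + q)² = (q + a)²` makes the Hilbert symbol trivial over any field. -/
lemma hilbertTrivial_of_add_ne_zero {k : Type*} [Field k] {A B q v w : k}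
    (h : (1 - A * v ^ 2) * (1 - B * w ^ 2) = 1 - q * q) (hq : q + A * v ^ 2 ≠ 0) :
    HilbertTrivial A B := by
  refine ⟨(1 + q) * v / (q + A * v ^ 2), (1 - A * v ^ 2) * w / (q + A * v ^ 2), ?_⟩
  rw [div_pow, div_pow, ← mul_div_assoc, ← mul_div_assoc, ← add_div,
    div_eq_one_iff_eq (pow_ne_zero 2 hq)]
  linear_combination (-(1 - A * v ^ 2)) * h

theorem stmt8 (p : ℕ) [Fact p.Prime] (hp : 2 < p) (A B Q : ℚ_[p])
    (hA : A ≠ 0) (hB : B ≠ 0) (hQ : Q ≠ 0) (hQsq : IsSquare Q)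
    (hsol : ∃ v w : ℚ_[p], v ≠ 0 ∧ w ≠ 0 ∧
      (1 - A * v ^ 2) * (1 - B * w ^ 2) = 1 - Q) :
    HilbertTrivial A B := by
  obtain ⟨q, rfl⟩ := hQsq
  obtain ⟨v, w, -, -, h⟩ := hsol
  by_cases hq : q + A * v ^ 2 = 0
  · refine hilbertTrivial_of_add_ne_zero (q := -q) (by rw [h]; ring) fun hq' => hQ ?_
    have hq0 : q = 0 := by linear_combination (hq - hq') / 2
    rw [hq0, mul_zero]
  · exact hilbertTrivial_of_add_ne_zero h hq
end

section
/- Let p > 2 be a prime, let A, B be nonzero elements of ℚ_p, and let Q be a nonzero square in ℚ_p with ν_p(Q) = 0 (i.e., Q is a unit of ℤ_p). Suppose there exist nonzero v, w ∈ ℚ_p with (1 − A·v²)(1 − B·w²) = 1 − Q. Then A is a square in ℚ_p, or B is a square in ℚ_p, or both ν_p(A) and ν_p(B) are even. -/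
theorem Padic.isSquare_one_sub_of_norm_lt_one {p : ℕ} [Fact p.Prime] (hp : 2 < p) {x : ℚ_[p]}
    (hx : ‖x‖ < 1) : IsSquare (1 - x) := by
  have h2 : ‖(2 : ℤ_[p])‖ = 1 := by
    have h : ‖((2 : ℕ) : ℤ_[p])‖ = 1 := by
      rw [PadicInt.norm_natCast_eq_one_iff]
      exact (Nat.coprime_primes Fact.out Nat.prime_two).2 hp.ne'
    exact_mod_cast h
  let y : ℤ_[p] := ⟨x, hx.le⟩
  have hy : ‖y‖ < 1 := hx
  let F : Polynomial ℤ_[p] := Polynomial.X ^ 2 - Polynomial.C (1 - y)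
  have hF : ‖F.aeval (1 : ℤ_[p])‖ < ‖F.derivative.aeval (1 : ℤ_[p])‖ ^ 2 := by
    simpa [F, one_add_one_eq_two, h2, Polynomial.aeval_def] using hy
  obtain ⟨z, hz, -⟩ := hensels_lemma hF
  have hz' : z ^ 2 = 1 - y := by
    simpa [F, Polynomial.aeval_def, sub_eq_zero] using hz
  refine ⟨z, ?_⟩
  rw [← pow_two, ← PadicInt.coe_pow, hz']
  exact (PadicInt.coe_sub 1 y).symm

theorem Padic.norm_eq_one_iff_valuation_eq_zero {p : ℕ} [Fact p.Prime] {x : ℚ_[p]}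
    (hx : x ≠ 0) : ‖x‖ = 1 ↔ x.valuation = 0 := by
  have h1 : (1 : ℝ) < p := by exact_mod_cast (Fact.out : p.Prime).one_lt
  rw [Padic.norm_eq_zpow_neg_valuation hx,
    zpow_eq_one_iff_right₀ (by positivity) h1.ne', neg_eq_zero]

theorem Padic.isSquare_of_one_sub_mul_one_sub_eq {p : ℕ} [Fact p.Prime] (hp : 2 < p)
    {a b Q : ℚ_[p]} (hQ : IsSquare Q) (hQn : ‖Q‖ = 1) (ha : ‖a‖ ≠ 1)
    (h : (1 - a) * (1 - b) = 1 - Q) : IsSquare b := by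
  have ha1 : 1 - a ≠ 0 := by
    intro h0
    apply ha
    rw [← sub_eq_zero.1 h0, norm_one]
  have hb : b = (Q - a) / (1 - a) := by
    rw [eq_div_iff ha1]
    linear_combination -h
  rcases lt_or_gt_of_ne ha with hlt | hgt
  · have hQ0 : Q ≠ 0 := by
      rintro rfl
      simp at hQn
    have hQa : Q - a = Q * (1 - a / Q) := by field_simp
    rw [hb, hQa]
    exact (hQ.mul (isSquare_one_sub_of_norm_lt_one hp (by rwa [norm_div, hQn, div_one]))).div
      (isSquare_one_sub_of_norm_lt_one hp hlt)
  · have ha0 : a ≠ 0 := by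
      rintro rfl
      norm_num at hgt
    have hinv : ‖a‖⁻¹ < 1 := inv_lt_one_of_one_lt₀ hgt
    have hden : 1 - a = -a * (1 - a⁻¹) := by field_simp; ring
    have hnum : Q - a = -a * (1 - Q / a) := by field_simp; ring
    rw [hb, hden, hnum, mul_div_mul_left _ _ (neg_ne_zero.2 ha0)]
    exact (isSquare_one_sub_of_norm_lt_one hp (by rwa [norm_div, hQn, one_div])).div
      (isSquare_one_sub_of_norm_lt_one hp (by rwa [norm_inv]))

theorem Padic.norm_mul_sq_ne_one_of_odd_valuation {p : ℕ} [Fact p.Prime] {A v : ℚ_[p]}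
    (hA : A ≠ 0) (hv : v ≠ 0) (h : ¬ Even A.valuation) : ‖A * v ^ 2‖ ≠ 1 := by
  have hv2 : v ^ 2 ≠ 0 := pow_ne_zero 2 hv
  rw [Ne, norm_eq_one_iff_valuation_eq_zero (mul_ne_zero hA hv2),
    Padic.valuation_mul hA hv2, Padic.valuation_pow]
  push_cast
  contrapose! h
  exact ⟨-v.valuation, by lia⟩

theorem isSquare_of_isSquare_mul_sq {K : Type*} [Field K] {a v : K} (hv : v ≠ 0)
    (h : IsSquare (a * v ^ 2)) : IsSquare a := by
  simpa [hv] using h.div (IsSquare.sq v)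

theorem stmt9 (p : ℕ) [Fact p.Prime] (hp : 2 < p) (A B Q : ℚ_[p])
    (hA : A ≠ 0) (hB : B ≠ 0) (hQ : Q ≠ 0) (hQsq : IsSquare Q)
    (hQu : Q.valuation = 0)
    (hsol : ∃ v w : ℚ_[p], v ≠ 0 ∧ w ≠ 0 ∧
      (1 - A * v ^ 2) * (1 - B * w ^ 2) = 1 - Q) :
    IsSquare A ∨ IsSquare B ∨ (Even A.valuation ∧ Even B.valuation) := by
  obtain ⟨v, w, hv, hw, h⟩ := hsol
  have hQn : ‖Q‖ = 1 := (Padic.norm_eq_one_iff_valuation_eq_zero hQ).2 hQu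
  by_cases hAe : Even A.valuation
  · by_cases hBe : Even B.valuation
    · exact .inr (.inr ⟨hAe, hBe⟩)
    · exact .inl (isSquare_of_isSquare_mul_sq hv
        (Padic.isSquare_of_one_sub_mul_one_sub_eq hp hQsq hQn
          (Padic.norm_mul_sq_ne_one_of_odd_valuation hB hw hBe) (by rw [mul_comm, h])))
  · exact .inr (.inl (isSquare_of_isSquare_mul_sq hw
      (Padic.isSquare_of_one_sub_mul_one_sub_eq hp hQsq hQn
        (Padic.norm_mul_sq_ne_one_of_odd_valuation hA hv hAe) h)))
end

section
/- Let p > 2 be a prime, let A, B be nonzero elements of ℚ_p, and let Q be a nonzero square in ℚ_p with ν_p(Q) = 0 and ν_p(Q − 1) ≥ 1 (i.e., Q is a unit of ℤ_p congruent to 1 modulo p). Suppose there exist nonzero v, w ∈ ℚ_p with (1 − A·v²)(1 − B·w²) = 1 − Q. Then A is a square in ℚ_p or B is a square in ℚ_p. -/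
/-- For odd `p`, every `p`-adic number congruent to `1` modulo `p` is a square. -/
theorem isSquare_of_norm_one_sub_lt_one {p : ℕ} [Fact p.Prime] (hp : 2 < p) {a : ℚ_[p]}
    (ha : ‖1 - a‖ < 1) : IsSquare a := by
  have ha1 : ‖a‖ ≤ 1 := by
    have h := Padic.nonarchimedean 1 (-(1 - a))
    rw [norm_neg, norm_one, max_eq_left ha.le] at h
    simpa using h
  have h2 : ‖(2 : ℤ_[p])‖ = 1 := by
    have h : ‖((2 : ℕ) : ℤ_[p])‖ = 1 := by
      rw [PadicInt.norm_natCast_eq_one_iff]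
      exact (Nat.coprime_primes Fact.out Nat.prime_two).2 hp.ne'
    exact_mod_cast h
  let b : ℤ_[p] := ⟨a, ha1⟩
  obtain ⟨z, hz, -⟩ := hensels_lemma
    (F := (Polynomial.X ^ 2 - Polynomial.C b : Polynomial ℤ_[p])) (a := (1 : ℤ_[p])) (by
      have h : ‖1 - b‖ < 1 := ha
      simpa [one_add_one_eq_two, h2] using h)
  refine ⟨z, ?_⟩
  have hz' : z ^ 2 = b := by simpa [sub_eq_zero] using hz
  rw [← sq]
  exact (congrArg (Subtype.val) hz').symm

theorem stmt10 (p : ℕ) [Fact p.Prime] (hp : 2 < p) (A B Q : ℚ_[p])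
    (hA : A ≠ 0) (hB : B ≠ 0) (hQ : Q ≠ 0) (hQsq : IsSquare Q)
    (hQu : Q.valuation = 0)
    (hQ1 : Q = 1 ∨ 1 ≤ (Q - 1).valuation)
    (hsol : ∃ v w : ℚ_[p], v ≠ 0 ∧ w ≠ 0 ∧
      (1 - A * v ^ 2) * (1 - B * w ^ 2) = 1 - Q) :
    IsSquare A ∨ IsSquare B := by
  obtain ⟨v, w, hv, hw, h⟩ := hsol
  have isSquare_of_mul : ∀ {C u : ℚ_[p]}, u ≠ 0 → ‖1 - C * u ^ 2‖ < 1 → IsSquare C := by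
    intro C u hu hC
    have hs := (isSquare_of_norm_one_sub_lt_one hp hC).div (IsSquare.sq u)
    rwa [mul_div_cancel_right₀ _ (pow_ne_zero 2 hu)] at hs
  have hlt : ‖1 - Q‖ < 1 := by
    rcases hQ1 with rfl | hQ1
    · simp
    · have hne : Q - 1 ≠ 0 := by
        intro h0
        simp [h0] at hQ1
      rw [norm_sub_rev, Padic.norm_eq_zpow_neg_valuation hne]
      exact zpow_lt_one_of_neg₀ (by exact_mod_cast (by omega : 1 < p)) (by omega)
  rw [← h, norm_mul] at hlt
  rcases lt_or_ge ‖1 - A * v ^ 2‖ 1 with hl | hl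
  · exact .inl (isSquare_of_mul hv hl)
  · refine .inr (isSquare_of_mul hw (lt_of_le_of_lt ?_ hlt))
    exact le_mul_of_one_le_left (norm_nonneg _) hl
end

section
/- Let p be an odd prime and let c ∈ 𝔽_p be a square with c ≠ 0 and c ≠ 1. Then there exist non-squares U₁, U₂ ∈ 𝔽_p (necessarily nonzero) such that (1 − U₁)(1 − U₂) = 1 − c. -/
/-- The quadratic character sum of `(u - 1) * (u - c)` over a finite field is `-1` for `c ≠ 1`. -/
theorem sum_quadraticChar_sub_one_mul_sub {F : Type*} [Field F] [Fintype F] [DecidableEq F]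
    (hF : ringChar F ≠ 2) {c : F} (hc1 : c ≠ 1) :
    ∑ u : F, quadraticChar F ((u - 1) * (u - c)) = -1 := by
  have h1c : 1 - c ≠ 0 := sub_ne_zero.mpr hc1.symm
  have hJ := jacobiSum_nontrivial_inv (quadraticChar_ne_one hF)
  rw [(quadraticChar_isQuadratic F).inv, jacobiSum] at hJ
  have hbij : Function.Bijective fun x : F => 1 - (1 - c) * x :=
    Finite.injective_iff_bijective.mp fun x y hxy =>
      mul_left_cancel₀ h1c (sub_right_injective hxy)
  have hterm (x : F) : quadraticChar F ((1 - (1 - c) * x - 1) * (1 - (1 - c) * x - c)) =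
      quadraticChar F (-1) * (quadraticChar F x * quadraticChar F (1 - x)) := by
    rw [show (1 - (1 - c) * x - 1) * (1 - (1 - c) * x - c) =
      (1 - c) ^ 2 * (-1 * (x * (1 - x))) by ring, map_mul, quadraticChar_sq_one' h1c, one_mul,
      map_mul, map_mul]
  rw [← hbij.sum_comp, Finset.sum_congr rfl fun x _ => hterm x, ← Finset.mul_sum, hJ,
    mul_neg, ← sq, quadraticChar_sq_one (neg_ne_zero.mpr one_ne_zero)]

/-- Some `u` satisfies `χ u ≠ 1` and `χ ((u - 1) * (u - c)) ≠ 1` for the quadratic character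
`χ`: summing `(1 - χ u) * (1 - χ ((u - 1) * (u - c)))` over `u` gives one more than the number of
affine points of `y ^ 2 = u * (u - 1) * (u - c)`. -/
theorem exists_quadraticChar_ne_one_and_ne_one {F : Type*} [Field F] [Fintype F] [DecidableEq F]
    (hF : ringChar F ≠ 2) {c : F} (hc1 : c ≠ 1) :
    ∃ u : F, quadraticChar F u ≠ 1 ∧ quadraticChar F ((u - 1) * (u - c)) ≠ 1 := by
  by_contra! h
  have hzero : ∑ u : F, (1 - quadraticChar F u) *
      (1 - quadraticChar F ((u - 1) * (u - c))) = 0 := by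
    refine Finset.sum_eq_zero fun u _ => ?_
    by_cases hu : quadraticChar F u = 1
    · simp [hu]
    · simp [h u hu]
  have hnonneg : 0 ≤ ∑ u : F, (1 + quadraticChar F (u * ((u - 1) * (u - c)))) := by
    refine Finset.sum_nonneg fun u _ => ?_
    rcases quadraticChar_isQuadratic F (u * ((u - 1) * (u - c))) with h | h | h <;> simp [h]
  have hexpand : ∑ u : F, (1 - quadraticChar F u) *
      (1 - quadraticChar F ((u - 1) * (u - c))) =
      ∑ u : F, (1 + quadraticChar F (u * ((u - 1) * (u - c)))) - ∑ u : F, quadraticChar F u -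
        ∑ u : F, quadraticChar F ((u - 1) * (u - c)) := by
    rw [← Finset.sum_sub_distrib, ← Finset.sum_sub_distrib]
    refine Finset.sum_congr rfl fun u _ => ?_
    rw [map_mul (quadraticChar F) u]
    ring
  rw [hzero, quadraticChar_sum_zero hF, sum_quadraticChar_sub_one_mul_sub hF hc1] at hexpand
  linarith

theorem stmt11 (p : ℕ) (hp : p.Prime) (hodd : p ≠ 2) (c : ZMod p)
    (hcsq : IsSquare c) (hc0 : c ≠ 0) (hc1 : c ≠ 1) :
    ∃ U₁ U₂ : ZMod p, ¬IsSquare U₁ ∧ ¬IsSquare U₂ ∧ (1 - U₁) * (1 - U₂) = 1 - c := by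
  have : Fact p.Prime := ⟨hp⟩
  have hF : ringChar (ZMod p) ≠ 2 := by rwa [ZMod.ringChar_zmod_n]
  obtain ⟨u, hu, hg⟩ := exists_quadraticChar_ne_one_and_ne_one hF hc1
  have hu0 : u ≠ 0 := by
    rintro rfl
    exact hg (by simpa using (quadraticChar_one_iff_isSquare hc0).mpr hcsq)
  have husq : ¬IsSquare u := fun h => hu ((quadraticChar_one_iff_isSquare hu0).mpr h)
  have hu1 : u - 1 ≠ 0 := sub_ne_zero.mpr fun h => husq (h ▸ IsSquare.one)
  have huc : u - c ≠ 0 := sub_ne_zero.mpr fun h => husq (h ▸ hcsq)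
  refine ⟨u, (u - c) / (u - 1), husq, fun ⟨t, ht⟩ => hg ?_, ?_⟩
  · rw [quadraticChar_one_iff_isSquare (mul_ne_zero hu1 huc)]
    rw [div_eq_iff hu1] at ht
    exact ⟨t * (u - 1), by rw [ht]; ring⟩
  · field_simp
    ring
end

section
/- Let p be a prime, let a, b, a', b' ∈ ℚ_p, and let (x, u, z) ∈ ℚ_p³ satisfy z ≠ 0 and z² = x(x−a)(x−b)·u(u−a')(u−b'). Then the following three conditions are equivalent: (i) the Hilbert symbol ((x−a)(x−b), (u−a')(u−b'))_{ℚ_p} is trivial; (ii) the Hilbert symbol ((x−a)(x−b), −xu)_{ℚ_p} is trivial; (iii) the Hilbert symbol (−xu, (u−a')(u−b'))_{ℚ_p} is trivial. (Note that z ≠ 0 forces all of x, u, x−a, x−b, u−a', u−b' to be nonzero.) -/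
theorem hilbertTrivial_comm {k : Type*} [Field k] {A B : k} :
    HilbertTrivial A B ↔ HilbertTrivial B A :=
  ⟨HilbertTrivial.symm, HilbertTrivial.symm⟩

/-- An isotropic binary form `⟨A, B⟩` is hyperbolic, so it represents `1`. -/
theorem hilbertTrivial_of_eq_neg_mul_sq {k : Type*} [Field k] (h2 : (2 : k) ≠ 0) {A B t : k}
    (hA : A ≠ 0) (h : A = -(B * t ^ 2)) : HilbertTrivial A B := by
  have hB : B ≠ 0 := by
    rintro rfl
    simp_all
  have ht : t ≠ 0 := by
    rintro rfl
    simp_all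
  refine ⟨(1 - 1 / B) / (2 * t), (1 + 1 / B) / 2, ?_⟩
  rw [h]
  field_simp
  ring

/-- `(A, B)` trivial implies `(A, C)` trivial when `C` and `-AB` agree modulo squares. -/
theorem HilbertTrivial.of_mul_eq_neg_sq {k : Type*} [Field k] (h2 : (2 : k) ≠ 0) {A B C z : k}
    (hz : z ≠ 0) (hABC : A * B * C = -z ^ 2) (h : HilbertTrivial A B) :
    HilbertTrivial A C := by
  have hprod : A * B * C ≠ 0 := by
    rw [hABC]
    exact neg_ne_zero.mpr (pow_ne_zero 2 hz)
  have hC : C ≠ 0 := right_ne_zero_of_mul hprod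
  have hA : A ≠ 0 := left_ne_zero_of_mul (left_ne_zero_of_mul hprod)
  obtain ⟨r, s, hrs⟩ := h
  have key : A + C * (z * s / C) ^ 2 = A ^ 2 * r ^ 2 := by
    field_simp
    linear_combination (-A * C) * hrs + s ^ 2 * hABC
  by_cases hr : r = 0
  · refine hilbertTrivial_of_eq_neg_mul_sq h2 hA (t := z * s / C) ?_
    rw [hr] at key
    linear_combination key
  · refine ⟨1 / (A * r), (z * s / C) / (A * r), ?_⟩
    rw [div_pow, div_pow, ← mul_div_assoc, ← mul_div_assoc, ← add_div, one_pow, mul_one, key,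
      ← mul_pow]
    exact div_self (pow_ne_zero 2 (mul_ne_zero hA hr))

/-- If `-ABC` is a nonzero square, then `(A, B)` and `(A, C)` are trivial simultaneously. -/
theorem hilbertTrivial_iff_of_mul_eq_neg_sq {k : Type*} [Field k] (h2 : (2 : k) ≠ 0)
    {A B C z : k} (hz : z ≠ 0) (hABC : A * B * C = -z ^ 2) :
    HilbertTrivial A B ↔ HilbertTrivial A C :=
  ⟨.of_mul_eq_neg_sq h2 hz hABC,
    .of_mul_eq_neg_sq h2 hz (by rw [mul_right_comm, hABC])⟩

theorem stmt13 (p : ℕ) [Fact p.Prime] (a b a' b' : ℚ_[p]) (x u z : ℚ_[p])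
    (hz : z ≠ 0)
    (heq : z ^ 2 = x * (x - a) * (x - b) * (u * (u - a') * (u - b'))) :
    (HilbertTrivial ((x - a) * (x - b)) ((u - a') * (u - b')) ↔
      HilbertTrivial ((x - a) * (x - b)) (-(x * u))) ∧
    (HilbertTrivial ((x - a) * (x - b)) (-(x * u)) ↔
      HilbertTrivial (-(x * u)) ((u - a') * (u - b'))) := by
  refine ⟨hilbertTrivial_iff_of_mul_eq_neg_sq two_ne_zero hz ?_,
    hilbertTrivial_comm.trans (hilbertTrivial_iff_of_mul_eq_neg_sq two_ne_zero hz ?_)⟩ <;>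
  linear_combination heq
end

section
/- Let C := (log(√2 + 1) + √2 − 1)/2. For a positive integer N, let A(N) denote the number of pairs (a, b) of positive integers such that a and b are perfect squares, a < b, a < N, and b − a < N. Then A(N)/N converges to C as N → ∞; i.e., A(N) is asymptotically C·N. -/
open Filter

/-- The number of pairs `(a, b)` of positive integers with `a` and `b` perfect squares,
`a < b`, `a < N` and `b - a < N`. -/
noncomputable def countSquarePairs (N : ℕ) : ℕ :=
  {q : ℕ × ℕ | 0 < q.1 ∧ (∃ m : ℕ, q.1 = m ^ 2) ∧ (∃ m : ℕ, q.2 = m ^ 2) ∧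
    q.1 < q.2 ∧ q.1 < N ∧ q.2 - q.1 < N}.ncard

/-- The pairs counted by `countSquarePairs`, parametrised by the square roots. -/
theorem countSquarePairs_eq_sum (N : ℕ) (hN : 0 < N) :
    countSquarePairs N = ∑ k ∈ Finset.range (Nat.sqrt (N - 1)),
      (Nat.sqrt (N + (k + 1) ^ 2 - 1) - (k + 1)) := by
  have hset : {q : ℕ × ℕ | 0 < q.1 ∧ (∃ m : ℕ, q.1 = m ^ 2) ∧ (∃ m : ℕ, q.2 = m ^ 2) ∧
      q.1 < q.2 ∧ q.1 < N ∧ q.2 - q.1 < N} =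
      (fun p : (_ : ℕ) × ℕ => ((p.1 + 1) ^ 2, p.2 ^ 2)) ''
        ((Finset.range (Nat.sqrt (N - 1))).sigma
          fun k => Finset.Ioc (k + 1) (Nat.sqrt (N + (k + 1) ^ 2 - 1)) :
            Finset ((_ : ℕ) × ℕ)) := by
    ext ⟨a, b⟩
    simp only [Set.mem_ofPred_eq, Set.mem_image, Finset.mem_coe, Finset.mem_sigma,
      Finset.mem_range, Finset.mem_Ioc, Prod.mk.injEq, Sigma.exists, Nat.lt_iff_add_one_le,
      Nat.le_sqrt']
    constructor
    · rintro ⟨h0, ⟨x, rfl⟩, ⟨y, rfl⟩, hxy, hx, hd⟩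
      obtain ⟨k, rfl⟩ : ∃ k, x = k + 1 :=
        Nat.exists_eq_succ_of_ne_zero (by rintro rfl; simp at h0)
      have : k + 1 < y := lt_of_pow_lt_pow_left₀ 2 (Nat.zero_le _) (by omega)
      exact ⟨k, y, ⟨by omega, by omega, by omega⟩, rfl, rfl⟩
    · rintro ⟨k, y, ⟨hk, hky, hy⟩, rfl, rfl⟩
      have h1 : (k + 1) ^ 2 < y ^ 2 := Nat.pow_lt_pow_left (by omega) two_ne_zero
      have h0 : 0 < (k + 1) ^ 2 := by positivity
      exact ⟨by omega, ⟨_, rfl⟩, ⟨_, rfl⟩, by omega, by omega, by omega⟩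
  have hinj : Function.Injective (fun p : (_ : ℕ) × ℕ => ((p.1 + 1) ^ 2, p.2 ^ 2)) := by
    rintro ⟨a, b⟩ ⟨c, d⟩ h
    simp only [Prod.mk.injEq] at h
    have h1 := Nat.pow_left_injective two_ne_zero h.1
    have h2 := Nat.pow_left_injective two_ne_zero h.2
    obtain rfl : a = c := by omega
    obtain rfl : b = d := h2
    rfl
  rw [countSquarePairs, hset, Set.ncard_image_of_injective _ hinj, Set.ncard_coe_finset,
    Finset.card_sigma]
  simp

theorem antitone_sqrt_one_add_sq_sub :
    Antitone fun t : ℝ => Real.sqrt (1 + t ^ 2) - t := by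
  intro a b hab
  have ha : a ≤ Real.sqrt (1 + a ^ 2) := Real.le_sqrt_of_sq_le (by linarith)
  have hb : Real.sqrt (1 + b ^ 2) ≤ Real.sqrt (1 + a ^ 2) + (b - a) := by
    rw [Real.sqrt_le_left (by have := Real.sqrt_nonneg (1 + a ^ 2); linarith)]
    have hs := Real.sq_sqrt (show (0 : ℝ) ≤ 1 + a ^ 2 by positivity)
    nlinarith [mul_nonneg (sub_nonneg.2 hab) (sub_nonneg.2 ha)]
  dsimp only
  linarith

/-- An antiderivative of `t ↦ √(1 + t ^ 2) - t`. -/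
noncomputable def sqrtSubPrimitive (t : ℝ) : ℝ :=
  (t * Real.sqrt (1 + t ^ 2) + Real.arsinh t - t ^ 2) / 2

theorem hasDerivAt_sqrtSubPrimitive (t : ℝ) :
    HasDerivAt sqrtSubPrimitive (Real.sqrt (1 + t ^ 2) - t) t := by
  have hpos : (0 : ℝ) < 1 + t ^ 2 := by positivity
  have hsq := Real.sq_sqrt hpos.le
  have hs : Real.sqrt (1 + t ^ 2) ≠ 0 := (Real.sqrt_pos.2 hpos).ne'
  have h1 : HasDerivAt (fun t : ℝ => Real.sqrt (1 + t ^ 2))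
      (2 * t / (2 * Real.sqrt (1 + t ^ 2))) t := by
    have := ((hasDerivAt_pow 2 t).const_add 1).sqrt hpos.ne'
    simpa using this
  have h2 := ((((hasDerivAt_id t).mul h1).add (Real.hasDerivAt_arsinh t)).sub
    (hasDerivAt_pow 2 t)).div_const 2
  refine h2.congr_deriv ?_
  simp only [id]
  field_simp
  push_cast
  linear_combination -hsq

theorem slope_bounds_of_antitone_deriv {F f : ℝ → ℝ} (hF : ∀ t, HasDerivAt F (f t) t)
    (hf : Antitone f) {a b : ℝ} (hab : a ≤ b) :
    f b * (b - a) ≤ F b - F a ∧ F b - F a ≤ f a * (b - a) := by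
  rcases hab.eq_or_lt with rfl | hlt
  · simp
  obtain ⟨c, hc, hslope⟩ := exists_hasDerivAt_eq_slope F f hlt
    (fun t _ => (hF t).continuousAt.continuousWithinAt) fun t _ => hF t
  have h0 : 0 < b - a := sub_pos.2 hlt
  rw [eq_div_iff h0.ne'] at hslope
  rw [← hslope]
  exact ⟨mul_le_mul_of_nonneg_right (hf hc.2.le) h0.le,
    mul_le_mul_of_nonneg_right (hf hc.1.le) h0.le⟩

/-- Right Riemann sums of an antitone function, compared with a primitive. -/
theorem riemannSum_bounds_of_antitone_deriv {F f : ℝ → ℝ} (hF : ∀ t, HasDerivAt F (f t) t)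
    (hf : Antitone f) {h : ℝ} (hh : 0 ≤ h) (M : ℕ) :
    (∑ k ∈ Finset.range M, f ((k + 1 : ℕ) * h)) * h ≤ F (M * h) - F 0 ∧
      F (M * h) - F 0 ≤
        (∑ k ∈ Finset.range M, f ((k + 1 : ℕ) * h)) * h + (f 0 - f (M * h)) * h := by
  induction M with
  | zero => simp
  | succ n ih =>
    have hle : (n : ℝ) * h ≤ (n + 1 : ℕ) * h := by gcongr; simp
    have hd : ((n + 1 : ℕ) : ℝ) * h - n * h = h := by push_cast; ring
    have hb := slope_bounds_of_antitone_deriv hF hf hle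
    rw [hd] at hb
    rw [Finset.sum_range_succ]
    constructor <;> linarith [ih.1, ih.2, hb.1, hb.2]

theorem nat_sqrt_sub_one_bounds {n : ℕ} (hn : 0 < n) :
    (Nat.sqrt (n - 1) : ℝ) ≤ Real.sqrt n ∧ Real.sqrt n ≤ Nat.sqrt (n - 1) + 1 := by
  constructor
  · refine Real.le_sqrt_of_sq_le ?_
    have := Nat.sqrt_le' (n - 1)
    exact_mod_cast (by omega : Nat.sqrt (n - 1) ^ 2 ≤ n)
  · rw [Real.sqrt_le_left (by positivity)]
    have := Nat.lt_succ_sqrt' (n - 1)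
    exact_mod_cast (by simp only [Nat.succ_eq_add_one] at this; omega :
      n ≤ (Nat.sqrt (n - 1) + 1) ^ 2)

theorem abs_countSquarePairs_div_sub_le (N : ℕ) (hN : 0 < N) :
    |(countSquarePairs N : ℝ) / N - sqrtSubPrimitive (Nat.sqrt (N - 1) * (Real.sqrt N)⁻¹)| ≤
      2 * (Real.sqrt N)⁻¹ := by
  have hNpos : (0 : ℝ) < N := by exact_mod_cast hN
  set s := Real.sqrt N with hs
  have hspos : 0 < s := Real.sqrt_pos.2 hNpos
  have hsq : s ^ 2 = N := Real.sq_sqrt hNpos.le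
  set M := Nat.sqrt (N - 1) with hM
  set f : ℝ → ℝ := fun t => Real.sqrt (1 + t ^ 2) - t with hfdef
  have hMs : (M : ℝ) ≤ s := (nat_sqrt_sub_one_bounds hN).1
  have hterm : ∀ k : ℕ,
      ((Nat.sqrt (N + (k + 1) ^ 2 - 1) - (k + 1) : ℕ) : ℝ) ≤ s * f ((k + 1 : ℕ) * s⁻¹) ∧
      s * f ((k + 1 : ℕ) * s⁻¹) ≤ ((Nat.sqrt (N + (k + 1) ^ 2 - 1) - (k + 1) : ℕ) : ℝ) + 1 := by
    intro k
    have hle : k + 1 ≤ Nat.sqrt (N + (k + 1) ^ 2 - 1) := by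
      rw [Nat.le_sqrt']; omega
    have hb := nat_sqrt_sub_one_bounds (n := N + (k + 1) ^ 2) (by omega)
    have hroot : s * f ((k + 1 : ℕ) * s⁻¹) =
        Real.sqrt ((N + (k + 1) ^ 2 : ℕ) : ℝ) - (k + 1 : ℕ) := by
      have : ((N + (k + 1) ^ 2 : ℕ) : ℝ) = s ^ 2 * (1 + ((k + 1 : ℕ) * s⁻¹) ^ 2) := by
        push_cast
        rw [← hsq]
        field_simp
      rw [this, Real.sqrt_mul (by positivity), Real.sqrt_sq hspos.le, hfdef]
      field_simp
    rw [hroot, Nat.cast_sub hle]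
    constructor <;> linarith [hb.1, hb.2]
  have hcount : (countSquarePairs N : ℝ) = ∑ k ∈ Finset.range M,
      ((Nat.sqrt (N + (k + 1) ^ 2 - 1) - (k + 1) : ℕ) : ℝ) := by
    rw [countSquarePairs_eq_sum N hN, Nat.cast_sum]
  have hupper : (countSquarePairs N : ℝ) ≤
      s * ∑ k ∈ Finset.range M, f ((k + 1 : ℕ) * s⁻¹) := by
    rw [hcount, Finset.mul_sum]
    exact Finset.sum_le_sum fun k _ => (hterm k).1
  have hlower : s * ∑ k ∈ Finset.range M, f ((k + 1 : ℕ) * s⁻¹) ≤ countSquarePairs N + M := by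
    rw [hcount, Finset.mul_sum]
    refine (Finset.sum_le_sum fun k _ => (hterm k).2).trans_eq ?_
    simp [Finset.sum_add_distrib]
  obtain ⟨hr1, hr2⟩ := riemannSum_bounds_of_antitone_deriv hasDerivAt_sqrtSubPrimitive
    antitone_sqrt_one_add_sq_sub (inv_pos.2 hspos).le M
  have hzero : sqrtSubPrimitive 0 = 0 := by simp [sqrtSubPrimitive]
  have hf0 : f 0 = 1 := by simp [hfdef]
  have hfM : 0 ≤ f (M * s⁻¹) := sub_nonneg.2 (Real.le_sqrt_of_sq_le (by linarith))
  change (∑ k ∈ Finset.range M, f ((k + 1 : ℕ) * s⁻¹)) * s⁻¹ ≤ _ at hr1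
  change _ ≤ (∑ k ∈ Finset.range M, f ((k + 1 : ℕ) * s⁻¹)) * s⁻¹ +
    (f 0 - f (M * s⁻¹)) * s⁻¹ at hr2
  rw [hzero, sub_zero] at hr1 hr2
  rw [hf0] at hr2
  set S := ∑ k ∈ Finset.range M, f ((k + 1 : ℕ) * s⁻¹)
  have hu : (countSquarePairs N : ℝ) / N ≤ S * s⁻¹ := by
    rw [div_le_iff₀ hNpos, ← hsq]
    refine hupper.trans_eq ?_
    field_simp
  have hl : S * s⁻¹ ≤ (countSquarePairs N : ℝ) / N + s⁻¹ := by
    have : S * s⁻¹ = s * S / N := by rw [← hsq]; field_simp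
    have h' : s⁻¹ = s / N := by rw [← hsq]; field_simp
    rw [this, h', ← add_div]
    gcongr
    linarith
  have hprod := mul_nonneg hfM (inv_pos.2 hspos).le
  rw [abs_le]
  constructor <;> linarith [inv_pos.2 hspos]

theorem tendsto_inv_sqrt_natCast :
    Tendsto (fun N : ℕ => (Real.sqrt N)⁻¹) atTop (nhds 0) :=
  tendsto_inv_atTop_zero.comp (Real.tendsto_sqrt_atTop.comp tendsto_natCast_atTop_atTop)

theorem tendsto_nat_sqrt_sub_one_mul_inv_sqrt :
    Tendsto (fun N : ℕ => (Nat.sqrt (N - 1) : ℝ) * (Real.sqrt N)⁻¹) atTop (nhds 1) := by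
  have hlow : Tendsto (fun N : ℕ => 1 - (Real.sqrt N)⁻¹) atTop (nhds 1) := by
    simpa using tendsto_inv_sqrt_natCast.const_sub 1
  refine tendsto_of_tendsto_of_tendsto_of_le_of_le' hlow tendsto_const_nhds ?_ ?_ <;>
    filter_upwards [eventually_gt_atTop 0] with N hN
  all_goals
    have hb := nat_sqrt_sub_one_bounds hN
    have hs : 0 < Real.sqrt N := Real.sqrt_pos.2 (by exact_mod_cast hN)
    rw [← div_eq_mul_inv]
  · rw [le_div_iff₀ hs, sub_mul, inv_mul_cancel₀ hs.ne']
    linarith [hb.2]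
  · rw [div_le_one hs]
    exact hb.1

theorem stmt15 :
    Tendsto (fun N : ℕ => (countSquarePairs N : ℝ) / N) atTop
      (nhds ((Real.log (Real.sqrt 2 + 1) + Real.sqrt 2 - 1) / 2)) := by
  have hone : sqrtSubPrimitive 1 = (Real.log (Real.sqrt 2 + 1) + Real.sqrt 2 - 1) / 2 := by
    simp only [sqrtSubPrimitive, Real.arsinh]
    norm_num
    ring_nf
  rw [← hone]
  have hmain := (hasDerivAt_sqrtSubPrimitive 1).continuousAt.tendsto.comp
    tendsto_nat_sqrt_sub_one_mul_inv_sqrt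
  have herr : Tendsto (fun N : ℕ => (countSquarePairs N : ℝ) / N -
      sqrtSubPrimitive (Nat.sqrt (N - 1) * (Real.sqrt N)⁻¹)) atTop (nhds 0) := by
    refine squeeze_zero_norm' ?_ (by simpa using tendsto_inv_sqrt_natCast.const_mul 2)
    filter_upwards [eventually_gt_atTop 0] with N hN
    exact abs_countSquarePairs_div_sub_le N hN
  simpa using herr.add hmain
end

section
/- Consider the affine Kummer surface S: z² = x(x−1)(x−25)·u(u+25)(u+36). Let V ⊆ ℚ_5³ be the set of all (x, u, z) ∈ ℚ_5³ satisfying this equation, and let R ⊆ V be the subset of points all of whose coordinates are rational numbers (i.e., the image in ℚ_5³ of the rational solutions). Then R is not dense in V for the 5-adic topology; in particular, weak approximation fails for S at the prime 5. (This failure is caused by the transcendental Brauer class represented by the quaternion algebra ((x−1)(x−25), (u+25)(u+36)): for instance, 5-adic points with (x, u) = (17, 5) cannot be approximated by rational points.) -/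
instance : Fact (Nat.Prime 5) := ⟨by norm_num⟩

/-- The explicit form modulo 8 of the condition that the Hilbert symbol of `a` and `b` at the
prime 2 is trivial, for integers `a` and `b` not divisible by 4. -/
def HilbertTwo (a b : ℤ) : Prop :=
  (a % 2 = 1 → b % 2 = 1 → a % 4 = 1 ∨ b % 4 = 1) ∧
  (a % 2 = 0 → b % 2 = 1 → b % 8 = 1 ∨ (a + b) % 8 = 1) ∧
  (a % 2 = 1 → b % 2 = 0 → a % 8 = 1 ∨ (a + b) % 8 = 1) ∧
  (a % 2 = 0 → b % 2 = 0 → (a + b) % 16 = 0 ∨ (a + b) % 16 = 4)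

instance (a b : ℤ) : Decidable (HilbertTwo a b) := by
  unfold HilbertTwo; infer_instance

lemma mul_sq_parity (a X : ℤ) :
    (X % 2 = 0 ∧ ∃ k, a * X ^ 2 = 4 * k ∧ (a % 2 = 0 → k % 2 = 0)) ∨
      (X % 2 = 1 ∧ ∃ k, a * X ^ 2 = a + 8 * k ∧ (a % 2 = 0 → k % 2 = 0)) := by
  rcases Int.even_or_odd' X with ⟨t, rfl | rfl⟩
  · refine Or.inl ⟨by omega, a * t ^ 2, by ring, fun h ↦ ?_⟩
    simp [Int.mul_emod, h]
  · obtain ⟨l, hl⟩ : (2 : ℤ) ∣ t * (t + 1) := (Int.even_mul_succ_self t).two_dvd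
    refine Or.inr ⟨by omega, a * l, by linear_combination 4 * a * hl, fun h ↦ ?_⟩
    simp [Int.mul_emod, h]

lemma hilbertTwo_of_conic {a b X Y Z : ℤ} (ha : ¬(4 : ℤ) ∣ a) (hb : ¬(4 : ℤ) ∣ b)
    (h : a * X ^ 2 + b * Y ^ 2 = Z ^ 2) (hX : X ≠ 0) : HilbertTwo a b := by
  induction hN : X.natAbs using Nat.strong_induction_on generalizing X Y Z with
  | _ N ih =>
    by_cases hev : X % 2 = 0 ∧ Y % 2 = 0 ∧ Z % 2 = 0
    · obtain ⟨x, rfl⟩ : (2 : ℤ) ∣ X := by omega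
      obtain ⟨y, rfl⟩ : (2 : ℤ) ∣ Y := by omega
      obtain ⟨z, rfl⟩ : (2 : ℤ) ∣ Z := by omega
      exact ih x.natAbs (by omega) (X := x) (Y := y) (Z := z) (by linarith) (by omega) rfl
    · have h16 : Z % 2 = 0 → Z ^ 2 % 16 = 0 ∨ Z ^ 2 % 16 = 4 := by
        intro hz
        obtain ⟨z, rfl⟩ : (2 : ℤ) ∣ Z := by omega
        rcases mul_sq_parity 1 z with ⟨-, k, hk, -⟩ | ⟨-, k, hk, -⟩
        · left; rw [mul_pow]; omega
        · right; rw [mul_pow]; omega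
      have hZ := mul_sq_parity 1 Z
      have hXX := mul_sq_parity a X
      have hYY := mul_sq_parity b Y
      rw [one_mul] at hZ
      generalize a * X ^ 2 = u at *
      generalize b * Y ^ 2 = v at *
      generalize Z ^ 2 = w at *
      clear ih
      unfold HilbertTwo
      rcases hZ with ⟨hz, k, hk, -⟩ | ⟨hz, k, hk, -⟩ <;>
      rcases hXX with ⟨hx, l, hl, hl'⟩ | ⟨hx, l, hl, hl'⟩ <;>
      rcases hYY with ⟨hy, j, hj, hj'⟩ | ⟨hy, j, hj, hj'⟩ <;>
      refine ⟨?_, ?_, ?_, ?_⟩ <;> intro _ _ <;> omega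

lemma HilbertTwo.of_mul_left {a b C : ℤ} (hC : C % 8 = 1) (h : HilbertTwo (a * C) b) :
    HilbertTwo a b := by
  obtain ⟨k, rfl⟩ : ∃ k, C = 8 * k + 1 := ⟨C / 8, by omega⟩
  rcases Int.even_or_odd' a with ⟨t, rfl | rfl⟩
  · have : 2 * t * (8 * k + 1) = 2 * t + 16 * (t * k) := by ring
    rw [this] at h
    unfold HilbertTwo at *
    omega
  · have : (2 * t + 1) * (8 * k + 1) = 2 * t + 1 + 8 * ((2 * t + 1) * k) := by ring
    rw [this] at h
    unfold HilbertTwo at *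
    omega

lemma not_four_dvd_of_squarefree {a : ℤ} (ha : Squarefree a) : ¬(4 : ℤ) ∣ a := by
  intro h
  have := ha 2 (by simpa using h)
  norm_num [Int.isUnit_iff] at this

/-- If the form `X ^ 2 - b * Y ^ 2` represents `D`, then `a * b * D = - w ^ 2` gives a rational
point on the conic attached to `a` and `b`. -/
lemma hilbertTwo_of_norm {a b P Q w : ℤ} (ha : ¬(4 : ℤ) ∣ a) (hb : ¬(4 : ℤ) ∣ b)
    (h : a * b * (P ^ 2 - b * Q ^ 2) = -w ^ 2) (hw : w ≠ 0) : HilbertTwo a b :=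
  hilbertTwo_of_conic (X := w) (Y := a * P) (Z := a * b * Q) ha hb
    (by linear_combination a * h) hw

lemma not_dvd_of_isCoprime {p m n : ℤ} (hp : Prime p) (h : IsCoprime m n) (hm : p ∣ m) :
    ¬p ∣ n := fun hn ↦ hp.not_isUnit (h.isUnit_of_dvd' hm hn)

lemma two_mul_odd_ne_neg_sq {t v : ℤ} (ht : Odd t) : 2 * t ≠ -v ^ 2 := by
  intro h
  have := mul_sq_parity 1 v
  rw [Int.odd_iff] at ht
  omega

lemma emod_four_eq_one {b g r s q w : ℤ} (hb : Squarefree b) (hrs : IsCoprime r s)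
    (hg : b * g ^ 2 = -(r * s)) (hq : q % 4 = 3)
    (h : q * b * ((r + 25 * s) * (r + 36 * s)) = -w ^ 2) (hw : w ≠ 0) : b % 4 = 1 := by
  have hb4 := not_four_dvd_of_squarefree hb
  have hH : HilbertTwo q b := by
    refine hilbertTwo_of_norm (P := r - 30 * s) (Q := 11 * g) (w := w) (by omega) hb4 ?_ hw
    linear_combination h - q * b * 121 * hg
  suffices hodd : b % 2 = 1 by
    have := hH.1 (by omega) hodd
    omega
  by_contra hodd
  obtain ⟨c, rfl⟩ : (2 : ℤ) ∣ b := by omega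
  have hc : Odd c := by rw [Int.odd_iff]; omega
  have hqo : Odd q := by rw [Int.odd_iff]; omega
  rcases Int.even_or_odd r with hr | hr
  · have hs : Odd s := by
      rw [← Int.not_even_iff_odd, even_iff_two_dvd]
      exact not_dvd_of_isCoprime Int.prime_two hrs hr.two_dvd
    obtain ⟨r, rfl⟩ := hr.two_dvd
    have hw2 : (2 : ℤ) ∣ w := by
      apply Int.prime_two.dvd_of_dvd_pow (n := 2)
      rw [← dvd_neg, ← h]
      exact dvd_mul_of_dvd_left (dvd_mul_of_dvd_right (dvd_mul_right _ _) _) _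
    obtain ⟨w, rfl⟩ := hw2
    have h1 : q * c * ((2 * r + 25 * s) * (r + 18 * s)) = -w ^ 2 := by linarith
    have hg1 : c * g ^ 2 = -(r * s) := by linarith
    rcases Int.even_or_odd r with hr' | hr'
    · have hg2 : (2 : ℤ) ∣ g := by
        have : Even (c * g ^ 2) := by rw [hg1]; simp [hr']
        rcases Int.even_mul.1 this with h | h
        · exact absurd h (by simpa using hc)
        · exact (Int.even_pow.1 h).1.two_dvd
      obtain ⟨g, rfl⟩ := hg2
      have hr4 : (4 : ℤ) ∣ r := by
        have : (2 : ℤ) ^ 2 ∣ r * s := ⟨-(c * g ^ 2), by linarith⟩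
        have h2 : IsCoprime ((2 : ℤ) ^ 2) s := by
          apply IsCoprime.pow_left
          exact hrs.of_isCoprime_of_dvd_left ⟨r, rfl⟩
        simpa using h2.dvd_of_dvd_mul_right this
      obtain ⟨r, rfl⟩ := hr4
      have h3 : Odd (8 * r + 25 * s) := by rw [Int.odd_iff] at *; omega
      have h4 : Odd (2 * r + 9 * s) := by rw [Int.odd_iff] at *; omega
      exact two_mul_odd_ne_neg_sq ((hqo.mul hc).mul (h3.mul h4)) (v := w) (by linarith)
    · have hgo : Odd g := by
        have : Odd (c * g ^ 2) := by rw [hg1]; simp [hr', hs]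
        exact (Int.odd_pow' two_ne_zero).1 (Int.odd_mul.1 this).2
      have h3 : Odd (2 * r + 25 * s) := by rw [Int.odd_iff] at *; omega
      have h4 : Odd (r + 18 * s) := by rw [Int.odd_iff] at *; omega
      have hwo : Odd w := by
        rw [← Int.odd_pow' two_ne_zero, ← odd_neg, ← h1]
        exact (hqo.mul hc).mul (h3.mul h4)
      have sq_one {t : ℤ} (ht : Odd t) : (t : ZMod 4) ^ 2 = 1 := by
        have := Int.sq_mod_four_eq_one_of_odd ht
        exact_mod_cast (ZMod.intCast_eq_intCast_iff' (t ^ 2) 1 4).2 this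
      have hq3 : (q : ZMod 4) = 3 := by
        exact_mod_cast (ZMod.intCast_eq_intCast_iff' q 3 4).2 hq
      have h1' := congrArg (Int.cast : ℤ → ZMod 4) h1
      have hg' := congrArg (Int.cast : ℤ → ZMod 4) hg1
      obtain ⟨i, rfl⟩ := hr'
      obtain ⟨l, rfl⟩ := hs
      push_cast at h1' hg'
      rw [sq_one hgo, mul_one] at hg'
      rw [sq_one hwo, hg', hq3] at h1'
      revert h1'
      generalize (i : ZMod 4) = i
      generalize (l : ZMod 4) = l
      revert i l
      decide
  · have hs : Even s := by
      have : Even (r * s) := by rw [← even_neg, ← hg]; simp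
      rcases Int.even_mul.1 this with h | h
      · exact absurd h (by simpa using hr)
      · exact h
    have h3 : Odd (r + 25 * s) := by rw [Int.odd_iff, Int.even_iff] at *; omega
    have h4 : Odd (r + 36 * s) := by rw [Int.odd_iff, Int.even_iff] at *; omega
    exact two_mul_odd_ne_neg_sq ((hqo.mul hc).mul (h3.mul h4)) (v := w) (by linarith)

lemma exists_eq_sq_mul_of_odd {m n : ℤ} (hm : Odd m) (hn : Odd n) (h : (m * n) % 8 ≠ 1) :
    ∃ c q : ℤ, c ≠ 0 ∧ (m - n) * (m - 25 * n) = c ^ 2 * q ∧ (m * n * q) % 4 = 3 := by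
  obtain ⟨k, hk⟩ := (hm.sub_odd hn).two_dvd
  obtain rfl : m = n + 2 * k := by linarith
  obtain ⟨i, rfl⟩ := hn
  rcases Int.even_or_odd' k with ⟨t, rfl | rfl⟩
  · rcases Int.even_or_odd' t with ⟨j, rfl | rfl⟩
    · obtain ⟨l, hl⟩ : (2 : ℤ) ∣ i * (i + 1) := (Int.even_mul_succ_self i).two_dvd
      have : (2 * i + 1 + 2 * (2 * (2 * j))) * (2 * i + 1) = 8 * (l + j * (2 * i + 1)) + 1 := by
        linear_combination 4 * hl
      omega
    · refine ⟨4, (2 * j + 1) * (2 * j + 1 - 6 * (2 * i + 1)), by norm_num, by ring, ?_⟩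
      ring_nf
      omega
  · refine ⟨2, (2 * t + 1) * (2 * t + 1 - 12 * (2 * i + 1)), by norm_num, by ring, ?_⟩
    ring_nf
    omega

lemma emod_eight_eq_one_of_even_of_odd {m n : ℤ} (hm : Even m) (hn : Odd n) :
    ((m - n) * (m - 25 * n)) % 8 = 1 ∧ ((n - m) * (n - 25 * m)) % 8 = 1 := by
  obtain ⟨i, rfl⟩ := hm.two_dvd
  obtain ⟨j, rfl⟩ := hn
  obtain ⟨k, hk⟩ : (2 : ℤ) ∣ j * (j + 1) := (Int.even_mul_succ_self j).two_dvd
  obtain ⟨l, hl⟩ : (2 : ℤ) ∣ i * (i + 1) := (Int.even_mul_succ_self i).two_dvd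
  have e1 : (2 * i - (2 * j + 1)) * (2 * i - 25 * (2 * j + 1)) =
      8 * (l - 7 * i - 13 * i * j + 25 * k + 3) + 1 := by linear_combination 4 * hl + 100 * hk
  have e2 : (2 * j + 1 - 2 * i) * (2 * j + 1 - 25 * (2 * i)) =
      8 * (25 * l - 19 * i - 13 * i * j + k) + 1 := by linear_combination 100 * hl + 4 * hk
  omega

lemma hilbertTwo_of_eq {a b f g m n r s w : ℤ} (ha : Squarefree a) (hb : Squarefree b)
    (hmn : IsCoprime m n) (hrs : IsCoprime r s) (hf : a * f ^ 2 = m * n)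
    (hg : b * g ^ 2 = -(r * s))
    (h : a * b * ((m - n) * (m - 25 * n)) * ((r + 25 * s) * (r + 36 * s)) = -w ^ 2)
    (hw : w ≠ 0) : HilbertTwo a b := by
  have ha4 := not_four_dvd_of_squarefree ha
  have hb4 := not_four_dvd_of_squarefree hb
  by_cases hC : ((m - n) * (m - 25 * n)) % 8 = 1
  · generalize (m - n) * (m - 25 * n) = C at *
    refine HilbertTwo.of_mul_left hC (hilbertTwo_of_norm (P := r - 30 * s) (Q := 11 * g)
      (w := w) ?_ hb4 ?_ hw)
    · obtain ⟨k, rfl⟩ : ∃ k, C = 8 * k + 1 := ⟨C / 8, by omega⟩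
      intro h4
      apply ha4
      have : a = a * (8 * k + 1) - 4 * (2 * a * k) := by ring
      omega
    · linear_combination h - a * C * b * 121 * hg
  have hmo : Odd m := by
    by_contra hm
    rw [Int.not_odd_iff_even] at hm
    have hn : Odd n := by
      rw [← Int.not_even_iff_odd, even_iff_two_dvd]
      exact not_dvd_of_isCoprime Int.prime_two hmn hm.two_dvd
    exact hC (emod_eight_eq_one_of_even_of_odd hm hn).1
  have hno : Odd n := by
    by_contra hn
    rw [Int.not_odd_iff_even] at hn
    exact hC (emod_eight_eq_one_of_even_of_odd hn hmo).2
  have haf : Odd (a * f ^ 2) := hf ▸ hmo.mul hno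
  have hao : a % 2 = 1 := Int.odd_iff.1 (Int.odd_mul.1 haf).1
  have hfo : Odd f := (Int.odd_pow' two_ne_zero).1 (Int.odd_mul.1 haf).2
  obtain ⟨k, hk⟩ : ∃ k, a * f ^ 2 = a + 8 * k := by
    rcases mul_sq_parity a f with ⟨h0, -⟩ | ⟨-, k, hk, -⟩
    · rw [Int.odd_iff] at hfo
      omega
    · exact ⟨k, hk⟩
  by_cases ha1 : a % 8 = 1
  · unfold HilbertTwo
    omega
  obtain ⟨c, q, hc, hq, hq4⟩ := exists_eq_sq_mul_of_odd hmo hno (by omega)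
  have hcw : c ∣ w := by
    rw [← Int.pow_dvd_pow_iff two_ne_zero, ← dvd_neg, ← h, hq]
    exact ⟨a * b * q * ((r + 25 * s) * (r + 36 * s)), by ring⟩
  obtain ⟨v, rfl⟩ := hcw
  have hb1 : b % 4 = 1 := by
    refine emod_four_eq_one (q := a * q) (w := v) hb hrs hg ?_ ?_ (right_ne_zero_of_mul hw)
    · rw [← hf, hk] at hq4
      have : (a + 8 * k) * q = a * q + 4 * (2 * k * q) := by ring
      omega
    · apply mul_left_cancel₀ (pow_ne_zero 2 hc)
      rw [hq] at h
      linear_combination h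
  unfold HilbertTwo
  omega

open scoped NumberTheorySymbols

lemma jacobiSym_eq_one_of_dvd {p : ℕ} [Fact p.Prime] {a h t : ℤ}
    (H : (p : ℤ) ∣ a * h ^ 2 - t ^ 2) (ht : ¬(p : ℤ) ∣ t) : J(a | p) = 1 := by
  have hp : p.Prime := Fact.out
  have h1 : J(t ^ 2 | p) = 1 := by
    refine jacobiSym.sq_one' ?_
    rw [← Int.isCoprime_iff_gcd_eq_one, isCoprime_comm]
    exact (Nat.prime_iff_prime_int.1 hp).coprime_iff_not_dvd.2 ht
  rw [jacobiSym.mod_left' (Int.modEq_iff_dvd.2 H : t ^ 2 % p = _)] at h1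
  rw [jacobiSym.mul_left, jacobiSym.pow_left] at h1
  rcases jacobiSym.trichotomy h p with h0 | h0 | h0
  · simp [h0] at h1
  · simpa [h0] using h1
  · simpa [h0] using h1

lemma exists_eq_mul_of_mul_eq_neg_sq {p x w : ℤ} (hp : Prime p) (h : p * x = -w ^ 2) :
    ∃ v, w = p * v ∧ x = -(p * v ^ 2) := by
  obtain ⟨v, rfl⟩ : p ∣ w := hp.dvd_of_dvd_pow (n := 2) ⟨-x, by linarith⟩
  exact ⟨v, rfl, mul_left_cancel₀ hp.ne_zero (by linear_combination h)⟩

lemma Squarefree.not_dvd_of_mul {p a : ℤ} (hp : Prime p) (h : Squarefree (p * a)) : ¬p ∣ a := by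
  rintro ⟨k, rfl⟩
  exact hp.not_isUnit (h p ⟨k, by ring⟩)

lemma exists_dvd_sub_sq_left {p m n : ℤ} (hp : Prime p) (h5 : ¬p ∣ 5) (hmn : IsCoprime m n)
    (h : p ∣ m * n) : ∃ c, ¬p ∣ c ∧ p ∣ (m - n) * (m - 25 * n) - c ^ 2 := by
  rcases hp.dvd_or_dvd h with hm | hn
  · have hn := not_dvd_of_isCoprime hp hmn hm
    refine ⟨5 * n, by simp [hp.dvd_mul, h5, hn], ?_⟩
    obtain ⟨k, rfl⟩ := hm
    exact ⟨k * (p * k - 26 * n), by ring⟩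
  · have hm := not_dvd_of_isCoprime hp hmn.symm hn
    refine ⟨m, hm, ?_⟩
    obtain ⟨k, rfl⟩ := hn
    exact ⟨k * (25 * p * k - 26 * m), by ring⟩

lemma exists_dvd_sub_sq_right {p r s : ℤ} (hp : Prime p) (h2 : ¬p ∣ 2) (h5 : ¬p ∣ 5)
    (hrs : IsCoprime r s) (h : p ∣ r * s) (h3 : ¬p ∣ 3 ∨ p ∣ s) :
    ∃ c, ¬p ∣ c ∧ p ∣ (r + 25 * s) * (r + 36 * s) - c ^ 2 := by
  by_cases hs : p ∣ s
  · have hr := not_dvd_of_isCoprime hp hrs.symm hs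
    refine ⟨r, hr, ?_⟩
    obtain ⟨k, rfl⟩ := hs
    exact ⟨k * (900 * p * k + 61 * r), by ring⟩
  · replace h3 := h3.resolve_right hs
    refine ⟨2 * 3 * 5 * s, by simp only [hp.dvd_mul, h2, h3, h5, hs]; tauto, ?_⟩
    obtain ⟨k, rfl⟩ := (hp.dvd_or_dvd h).resolve_right hs
    exact ⟨k * (p * k + 61 * s), by ring⟩

lemma not_dvd_of_dvd_sub_sq {p C c : ℤ} (hp : Prime p) (hc : ¬p ∣ c) (h : p ∣ C - c ^ 2) :
    ¬p ∣ C := by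
  intro hC
  exact hc (hp.dvd_of_dvd_pow ((dvd_sub_right hC).1 h))

lemma jacobiSym_eq_one_of_dvd_left {p : ℕ} [Fact p.Prime] {a b f g m n r s w : ℤ}
    (h2 : ¬(p : ℤ) ∣ 2) (h5 : ¬(p : ℤ) ∣ 5) (ha : Squarefree a)
    (hmn : IsCoprime m n) (hrs : IsCoprime r s) (hf : a * f ^ 2 = m * n)
    (hg : b * g ^ 2 = -(r * s))
    (h : a * b * ((m - n) * (m - 25 * n)) * ((r + 25 * s) * (r + 36 * s)) = -w ^ 2)
    (hpa : (p : ℤ) ∣ a) (hpb : ¬(p : ℤ) ∣ b) : J(b | p) = 1 := by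
  have hp : Prime (p : ℤ) := Nat.prime_iff_prime_int.1 Fact.out
  obtain ⟨c, hc, hcC⟩ := exists_dvd_sub_sq_left hp h5 hmn
    (hf ▸ dvd_mul_of_dvd_left hpa _)
  have hC := not_dvd_of_dvd_sub_sq hp hc hcC
  generalize (m - n) * (m - 25 * n) = C at *
  obtain ⟨a, rfl⟩ := hpa
  have ha' := ha.not_dvd_of_mul hp
  have hD : (p : ℤ) ∣ (r + 25 * s) * (r + 36 * s) := by
    obtain ⟨v, rfl, hv⟩ := exists_eq_mul_of_mul_eq_neg_sq hp
      (x := a * b * C * ((r + 25 * s) * (r + 36 * s))) (by linarith)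
    have : (p : ℤ) ∣ a * b * C * ((r + 25 * s) * (r + 36 * s)) := by
      rw [hv, ← mul_neg]; exact dvd_mul_right _ _
    simpa only [hp.dvd_mul, ha', hpb, hC, false_or, or_false] using this
  rcases hp.dvd_or_dvd hD with hD | hD
  · have hs : ¬(p : ℤ) ∣ s := fun hs ↦ not_dvd_of_isCoprime hp hrs.symm hs
      ((dvd_add_left (dvd_mul_of_dvd_right hs 25)).1 hD)
    refine jacobiSym_eq_one_of_dvd (h := g) (t := 5 * s) ?_ (by simp [hp.dvd_mul, h5, hs])
    rw [hg]
    obtain ⟨k, hk⟩ := hD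
    exact ⟨-k * s, by linear_combination -s * hk⟩
  · have hs : ¬(p : ℤ) ∣ s := fun hs ↦ not_dvd_of_isCoprime hp hrs.symm hs
      ((dvd_add_left (dvd_mul_of_dvd_right hs 36)).1 hD)
    by_cases h3 : (p : ℤ) ∣ 3
    · obtain rfl : p = 3 := (Nat.prime_dvd_prime_iff_eq Fact.out Nat.prime_three).1
        (by exact_mod_cast h3)
      push_cast at *
      obtain ⟨r, rfl⟩ : 3 ∣ r := by omega
      obtain ⟨g, rfl⟩ : 3 ∣ g := by
        have : 3 ∣ b * g ^ 2 := ⟨-(r * s), by linarith⟩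
        exact hp.dvd_of_dvd_pow ((hp.dvd_or_dvd this).resolve_left hpb)
      obtain ⟨r, rfl⟩ : 3 ∣ r := by
        have : 3 ∣ r * s := ⟨-(b * g ^ 2), by linarith⟩
        exact (hp.dvd_or_dvd this).resolve_right hs
      obtain ⟨v, rfl, hv⟩ := exists_eq_mul_of_mul_eq_neg_sq hp
        (x := 9 * (a * b * C * ((9 * r + 25 * s) * (r + 4 * s)))) (w := w) (by linarith)
      obtain ⟨v, rfl, hv'⟩ := exists_eq_mul_of_mul_eq_neg_sq hp
        (x := a * b * C * ((9 * r + 25 * s) * (r + 4 * s))) (w := v) (by linarith)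
      have : (3 : ℤ) ∣ a * b * C * ((9 * r + 25 * s) * (r + 4 * s)) := by
        rw [hv', ← mul_neg]; exact dvd_mul_right _ _
      have h25 : ¬(3 : ℤ) ∣ 9 * r + 25 * s := by omega
      simp only [hp.dvd_mul, ha', hpb, hC, h25, false_or] at this
      refine jacobiSym_eq_one_of_dvd (h := g) (t := s) ?_ hs
      obtain ⟨k, hk⟩ := this
      have hg1 : b * g ^ 2 = -(r * s) := by linarith
      exact ⟨s * (s - k), by push_cast; linear_combination hg1 - s * hk⟩
    · refine jacobiSym_eq_one_of_dvd (h := g) (t := 2 * 3 * s) ?_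
        (by simp only [hp.dvd_mul, h2, h3, hs]; tauto)
      rw [hg]
      obtain ⟨k, hk⟩ := hD
      exact ⟨-k * s, by linear_combination -s * hk⟩

lemma jacobiSym_eq_one_of_dvd_right {p : ℕ} [Fact p.Prime] {a b f g m n r s w : ℤ}
    (h2 : ¬(p : ℤ) ∣ 2) (h5 : ¬(p : ℤ) ∣ 5) (hb : Squarefree b)
    (hmn : IsCoprime m n) (hrs : IsCoprime r s) (hf : a * f ^ 2 = m * n)
    (hg : b * g ^ 2 = -(r * s))
    (h : a * b * ((m - n) * (m - 25 * n)) * ((r + 25 * s) * (r + 36 * s)) = -w ^ 2)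
    (hpa : ¬(p : ℤ) ∣ a) (hpb : (p : ℤ) ∣ b) : J(a | p) = 1 := by
  have hp : Prime (p : ℤ) := Nat.prime_iff_prime_int.1 Fact.out
  have of_dvd (hC : (p : ℤ) ∣ (m - n) * (m - 25 * n)) : J(a | p) = 1 := by
    rcases hp.dvd_or_dvd hC with hC | hC
    · have hn : ¬(p : ℤ) ∣ n := fun hn ↦ not_dvd_of_isCoprime hp hmn.symm hn
        ((dvd_sub_left hn).1 hC)
      refine jacobiSym_eq_one_of_dvd (h := f) (t := n) ?_ hn
      rw [hf]
      obtain ⟨k, hk⟩ := hC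
      exact ⟨n * k, by linear_combination n * hk⟩
    · have hn : ¬(p : ℤ) ∣ n := fun hn ↦ not_dvd_of_isCoprime hp hmn.symm hn
        ((dvd_sub_left (dvd_mul_of_dvd_right hn 25)).1 hC)
      refine jacobiSym_eq_one_of_dvd (h := f) (t := 5 * n) ?_ (by simp [hp.dvd_mul, h5, hn])
      rw [hf]
      obtain ⟨k, hk⟩ := hC
      exact ⟨n * k, by linear_combination n * hk⟩
  have hrsp : (p : ℤ) ∣ r * s := by
    rw [← dvd_neg, ← hg]; exact dvd_mul_of_dvd_left hpb _
  obtain ⟨b, rfl⟩ := hpb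
  have hb' := hb.not_dvd_of_mul hp
  by_cases h3 : ¬(p : ℤ) ∣ 3 ∨ (p : ℤ) ∣ s
  · obtain ⟨d, hd, hdD⟩ := exists_dvd_sub_sq_right hp h2 h5 hrs hrsp h3
    have hD := not_dvd_of_dvd_sub_sq hp hd hdD
    apply of_dvd
    generalize (r + 25 * s) * (r + 36 * s) = D at *
    obtain ⟨v, rfl, hv⟩ := exists_eq_mul_of_mul_eq_neg_sq hp
      (x := a * b * ((m - n) * (m - 25 * n)) * D) (by linarith)
    have : (p : ℤ) ∣ a * b * ((m - n) * (m - 25 * n)) * D := by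
      rw [hv, ← mul_neg]; exact dvd_mul_right _ _
    rwa [hp.dvd_mul, or_iff_left hD, hp.dvd_mul, hp.dvd_mul, or_iff_right (not_or_intro hpa hb')]
      at this
  push Not at h3
  obtain ⟨h3, hs⟩ := h3
  obtain rfl : p = 3 := (Nat.prime_dvd_prime_iff_eq Fact.out Nat.prime_three).1
    (by exact_mod_cast h3)
  push_cast at *
  by_cases hC : (3 : ℤ) ∣ (m - n) * (m - 25 * n)
  · exact of_dvd hC
  obtain ⟨r, rfl⟩ : 3 ∣ r := (hp.dvd_or_dvd hrsp).resolve_right hs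
  have hg1 : b * g ^ 2 = -(r * s) := by linarith
  obtain ⟨v, rfl, hv⟩ := exists_eq_mul_of_mul_eq_neg_sq hp
    (x := 3 * (a * b * ((m - n) * (m - 25 * n)) * ((3 * r + 25 * s) * (r + 12 * s))))
    (w := w) (by linarith)
  have hv1 : a * b * ((m - n) * (m - 25 * n)) * ((3 * r + 25 * s) * (r + 12 * s)) = -v ^ 2 := by
    linarith
  by_cases hr : (3 : ℤ) ∣ r
  · obtain ⟨g, rfl⟩ : 3 ∣ g := by
      have : 3 ∣ b * g ^ 2 := by rw [hg1, dvd_neg]; exact dvd_mul_of_dvd_left hr _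
      exact hp.dvd_of_dvd_pow ((hp.dvd_or_dvd this).resolve_left hb')
    obtain ⟨r, rfl⟩ := hr
    obtain ⟨r, rfl⟩ : 3 ∣ r := by
      have : 3 ∣ r * s := ⟨-(b * g ^ 2), by linarith⟩
      exact (hp.dvd_or_dvd this).resolve_right hs
    obtain ⟨u, rfl, hu⟩ := exists_eq_mul_of_mul_eq_neg_sq hp
      (x := a * b * ((m - n) * (m - 25 * n)) * ((27 * r + 25 * s) * (3 * r + 4 * s)))
      (w := v) (by linarith)
    have : (3 : ℤ) ∣ a * b * ((m - n) * (m - 25 * n)) * ((27 * r + 25 * s) * (3 * r + 4 * s)) := by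
      rw [hu, ← mul_neg]; exact dvd_mul_right _ _
    have h25 : ¬(3 : ℤ) ∣ 27 * r + 25 * s := by omega
    have h4 : ¬(3 : ℤ) ∣ 3 * r + 4 * s := by omega
    rw [hp.dvd_mul, hp.dvd_mul, hp.dvd_mul, hp.dvd_mul (a := 27 * r + 25 * s)] at this
    tauto
  · have hmn3 : ¬(3 : ℤ) ∣ m - n := fun hd ↦ hC (dvd_mul_of_dvd_left hd _)
    have hdvd : (3 : ℤ) ∣ a * (r * s * (m - n)) ^ 2 - (v * g) ^ 2 := by
      refine ⟨-(a * r * s * (-8 * n * (m - n) * (r * s) +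
        (r ^ 2 + 20 * r * s + 100 * s ^ 2) * ((m - n) * (m - 25 * n)))), ?_⟩
      linear_combination -g ^ 2 * hv1 +
        a * ((m - n) * (m - 25 * n)) * ((3 * r + 25 * s) * (r + 12 * s)) * hg1
    refine jacobiSym_eq_one_of_dvd (h := r * s * (m - n)) (t := v * g) hdvd fun ht ↦ ?_
    have : (3 : ℤ) ∣ a * (r * s * (m - n)) ^ 2 :=
      (dvd_sub_left (dvd_pow ht two_ne_zero)).1 hdvd
    simp [hp.dvd_mul, hp.dvd_pow_iff_dvd, hpa, hr, hs, hmn3] at this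

lemma jacobiSym_eq_one_of_dvd_both {p : ℕ} [Fact p.Prime] {a b f g m n r s w : ℤ}
    (h2 : ¬(p : ℤ) ∣ 2) (h5 : ¬(p : ℤ) ∣ 5) (ha : Squarefree (p * a)) (hb : Squarefree (p * b))
    (hmn : IsCoprime m n) (hrs : IsCoprime r s) (hf : p * a * f ^ 2 = m * n)
    (hg : p * b * g ^ 2 = -(r * s))
    (h : p * a * (p * b) * ((m - n) * (m - 25 * n)) * ((r + 25 * s) * (r + 36 * s)) = -w ^ 2) :
    J(-(a * b) | p) = 1 := by
  have hp : Prime (p : ℤ) := Nat.prime_iff_prime_int.1 Fact.out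
  obtain ⟨c, hc, hcC⟩ := exists_dvd_sub_sq_left hp h5 hmn ⟨a * f ^ 2, by linarith⟩
  have hrsp : (p : ℤ) ∣ r * s := ⟨-(b * g ^ 2), by linarith⟩
  have ha' := ha.not_dvd_of_mul hp
  have hb' := hb.not_dvd_of_mul hp
  have hC := not_dvd_of_dvd_sub_sq hp hc hcC
  generalize (m - n) * (m - 25 * n) = C at *
  obtain ⟨v, rfl, hv⟩ := exists_eq_mul_of_mul_eq_neg_sq hp
    (x := p * (a * b * C * ((r + 25 * s) * (r + 36 * s)))) (w := w) (by linarith)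
  have hv1 : a * b * C * ((r + 25 * s) * (r + 36 * s)) = -v ^ 2 :=
    mul_left_cancel₀ hp.ne_zero (by linear_combination hv)
  have key (d D w : ℤ) (hd : ¬(p : ℤ) ∣ d) (hdD : (p : ℤ) ∣ D - d ^ 2)
      (hw : a * b * C * D = -w ^ 2) : J(-(a * b) | p) = 1 := by
    have hdvd : (p : ℤ) ∣ -(a * b) * (c * d) ^ 2 - w ^ 2 := by
      obtain ⟨i, hi⟩ := hcC
      obtain ⟨j, hj⟩ := hdD
      refine ⟨a * b * (i * d ^ 2 + C * j), ?_⟩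
      linear_combination -hw + a * b * d ^ 2 * hi + a * b * C * hj
    refine jacobiSym_eq_one_of_dvd hdvd fun ht ↦ ?_
    have := (dvd_sub_left (dvd_pow ht two_ne_zero)).1 hdvd
    simp [hp.dvd_mul, hp.dvd_pow_iff_dvd, ha', hb', hc, hd] at this
  by_cases h3 : ¬(p : ℤ) ∣ 3 ∨ (p : ℤ) ∣ s
  · obtain ⟨d, hd, hdD⟩ := exists_dvd_sub_sq_right hp h2 h5 hrs hrsp h3
    exact key d _ v hd hdD hv1
  push Not at h3
  obtain ⟨h3, hs⟩ := h3
  obtain rfl : p = 3 := (Nat.prime_dvd_prime_iff_eq Fact.out Nat.prime_three).1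
    (by exact_mod_cast h3)
  push_cast at *
  obtain ⟨r, rfl⟩ : 3 ∣ r := (hp.dvd_or_dvd hrsp).resolve_right hs
  have hg1 : b * g ^ 2 = -(r * s) := by linarith
  obtain ⟨v, rfl, hv'⟩ := exists_eq_mul_of_mul_eq_neg_sq hp
    (x := a * b * C * ((3 * r + 25 * s) * (r + 12 * s))) (w := v) (by linarith)
  have hr : (3 : ℤ) ∣ r := by
    have : (3 : ℤ) ∣ a * b * C * ((3 * r + 25 * s) * (r + 12 * s)) := by
      rw [hv', ← mul_neg]; exact dvd_mul_right _ _
    have h25 : ¬(3 : ℤ) ∣ 3 * r + 25 * s := by omega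
    simp only [hp.dvd_mul, ha', hb', hC, h25, false_or] at this
    omega
  obtain ⟨g, rfl⟩ : 3 ∣ g := by
    have : 3 ∣ b * g ^ 2 := by rw [hg1, dvd_neg]; exact dvd_mul_of_dvd_left hr _
    exact hp.dvd_of_dvd_pow ((hp.dvd_or_dvd this).resolve_left hb')
  obtain ⟨r, rfl⟩ := hr
  obtain ⟨r, rfl⟩ : 3 ∣ r := by
    have : 3 ∣ r * s := ⟨-(b * g ^ 2), by linarith⟩
    exact (hp.dvd_or_dvd this).resolve_right hs
  refine key (10 * s) ((27 * r + 25 * s) * (3 * r + 4 * s)) v (by omega)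
    ⟨r * (27 * r + 61 * s), by ring⟩ (by linarith)

/-- The value of the Jacobi symbol `J(e | n)` for `e ∈ {1, -1, 2, -2}` and `n` odd. -/
def unitTwoSymbol (e : ℤ) (n : ℕ) : ℤ :=
  if e = 1 then 1
  else if e = -1 then (if n % 4 = 1 then 1 else -1)
  else if e = 2 then (if n % 8 = 1 ∨ n % 8 = 7 then 1 else -1)
  else (if n % 8 = 1 ∨ n % 8 = 3 then 1 else -1)

/-- The sign in the law of quadratic reciprocity. -/
def reciprocitySign (m n : ℕ) : ℤ := if m % 4 = 3 ∧ n % 4 = 3 then -1 else 1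

lemma unitTwoSymbol_mod (e : ℤ) (n : ℕ) : unitTwoSymbol e (n % 8) = unitTwoSymbol e n := by
  simp [unitTwoSymbol, Nat.mod_mod_of_dvd]

lemma reciprocitySign_mod (m n : ℕ) :
    reciprocitySign (m % 8) (n % 8) = reciprocitySign m n := by
  simp [reciprocitySign, Nat.mod_mod_of_dvd]

lemma jacobiSym_eq_unitTwoSymbol {e : ℤ} (he : e ∈ ({1, -1, 2, -2} : Finset ℤ)) {n : ℕ}
    (hn : Odd n) : J(e | n) = unitTwoSymbol e n := by
  have h2 := Nat.odd_iff.1 hn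
  simp only [Finset.mem_insert, Finset.mem_singleton] at he
  rcases he with rfl | rfl | rfl | rfl
  · simp [unitTwoSymbol]
  · rw [jacobiSym.at_neg_one hn, ZMod.χ₄_nat_eq_if_mod_four, h2]
    simp [unitTwoSymbol]
  · rw [jacobiSym.at_two hn, ZMod.χ₈_nat_eq_if_mod_eight, h2]
    simp [unitTwoSymbol]
  · rw [jacobiSym.at_neg_two hn, ZMod.χ₈'_nat_eq_if_mod_eight, h2]
    simp [unitTwoSymbol]

lemma jacobiSym_mul_jacobiSym {m n : ℕ} (hm : Odd m) (hn : Odd n) (h : m.Coprime n) :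
    J(m | n) * J(n | m) = reciprocitySign m n := by
  have h1 : J(n | m) ^ 2 = 1 := jacobiSym.sq_one (by simpa using h.symm)
  rw [← jacobiSym.quadratic_reciprocity_if (Nat.odd_iff.1 hm) (Nat.odd_iff.1 hn),
    reciprocitySign]
  split_ifs
  · linear_combination -h1
  · linear_combination h1

lemma HilbertTwo.mod_eight {e₁ e₂ : ℤ} (h₁ : e₁ ∈ ({1, -1, 2, -2} : Finset ℤ))
    (h₂ : e₂ ∈ ({1, -1, 2, -2} : Finset ℤ)) {M N : ℕ} (hM : Odd M) (hN : Odd N)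
    (h : HilbertTwo (e₁ * M) (e₂ * N)) :
    HilbertTwo (e₁ * (M % 8 : ℕ)) (e₂ * (N % 8 : ℕ)) := by
  simp only [Finset.mem_insert, Finset.mem_singleton] at h₁ h₂
  rw [Nat.odd_iff] at hM hN
  unfold HilbertTwo at *
  rcases h₁ with rfl | rfl | rfl | rfl <;> rcases h₂ with rfl | rfl | rfl | rfl <;> omega

lemma reciprocity_residues : ∀ e₁ ∈ ({1, -1, 2, -2} : Finset ℤ),
    ∀ e₂ ∈ ({1, -1, 2, -2} : Finset ℤ), ¬(e₁ < 0 ∧ e₂ < 0) →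
    ∀ A ∈ ({1, 3, 5, 7} : Finset ℕ), ∀ B ∈ ({1, 3, 5, 7} : Finset ℕ),
    ∀ d ∈ ({1, 3, 5, 7} : Finset ℕ),
    HilbertTwo (e₁ * ((A * d % 8 : ℕ) : ℤ)) (e₂ * ((B * d % 8 : ℕ) : ℤ)) →
    unitTwoSymbol e₂ A * unitTwoSymbol e₁ B *
      (unitTwoSymbol (-1) d * unitTwoSymbol e₁ d * unitTwoSymbol e₂ d) *
      (reciprocitySign A B * reciprocitySign A d * reciprocitySign B d) = 1 := by
  decide +kernel

/-- The product formula for the Hilbert symbols of `e₁ * A * d` and `e₂ * B * d`. -/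
lemma jacobiSym_mul_eq_one {e₁ e₂ : ℤ} (h₁ : e₁ ∈ ({1, -1, 2, -2} : Finset ℤ))
    (h₂ : e₂ ∈ ({1, -1, 2, -2} : Finset ℤ)) {A B d : ℕ} (hA : Odd A) (hB : Odd B) (hd : Odd d)
    (hAB : A.Coprime B) (hAd : A.Coprime d) (hBd : B.Coprime d) (hneg : ¬(e₁ < 0 ∧ e₂ < 0))
    (hH : HilbertTwo (e₁ * (A * d : ℕ)) (e₂ * (B * d : ℕ))) :
    J(e₂ * (B * d : ℕ) | A) * J(e₁ * (A * d : ℕ) | B) * J(-(e₁ * A * (e₂ * B)) | d) = 1 := by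
  have mem {n : ℕ} (hn : Odd n) : n % 8 ∈ ({1, 3, 5, 7} : Finset ℕ) := by
    rw [Nat.odd_iff] at hn
    simp only [Finset.mem_insert, Finset.mem_singleton]
    omega
  have key := reciprocity_residues e₁ h₁ e₂ h₂ hneg _ (mem hA) _ (mem hB) _ (mem hd)
    (by rw [← Nat.mul_mod, ← Nat.mul_mod]; exact hH.mod_eight h₁ h₂ (hA.mul hd) (hB.mul hd))
  simp only [unitTwoSymbol_mod, reciprocitySign_mod] at key
  rw [← key, ← jacobiSym_eq_unitTwoSymbol h₂ hA, ← jacobiSym_eq_unitTwoSymbol h₁ hB,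
    ← jacobiSym_eq_unitTwoSymbol (by decide) hd, ← jacobiSym_eq_unitTwoSymbol h₁ hd,
    ← jacobiSym_eq_unitTwoSymbol h₂ hd, ← jacobiSym_mul_jacobiSym hA hB hAB,
    ← jacobiSym_mul_jacobiSym hA hd hAd, ← jacobiSym_mul_jacobiSym hB hd hBd,
    neg_eq_neg_one_mul (e₁ * A * (e₂ * B))]
  push_cast
  simp only [jacobiSym.mul_left]
  ring

lemma jacobiSym_eq_one_of_forall_prime {a : ℤ} {n : ℕ}
    (h : ∀ p, p.Prime → p ∣ n → J(a | p) = 1) : J(a | n) = 1 := by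
  induction n using Nat.recOnMul with
  | zero => simp
  | one => simp
  | prime p hp => exact h p hp dvd_rfl
  | mul m n hm hn =>
    rcases eq_or_ne m 0 with rfl | hm0
    · simp
    rcases eq_or_ne n 0 with rfl | hn0
    · simp
    rw [jacobiSym.mul_right' a hm0 hn0, hm fun p hp hd ↦ h p hp (hd.mul_right n),
      hn fun p hp hd ↦ h p hp (hd.mul_left m), one_mul]

lemma exists_eq_mul_odd {a : ℤ} (ha : Squarefree a) :
    ∃ e ∈ ({1, -1, 2, -2} : Finset ℤ), ∃ N : ℕ, Odd N ∧ Squarefree N ∧ a = e * N := by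
  rcases Int.even_or_odd a with h | h
  · obtain ⟨c, rfl⟩ := h.two_dvd
    have hc : Squarefree c.natAbs := Int.squarefree_natAbs.2 (ha.of_mul_right)
    have ho : Odd c.natAbs := by
      rw [Int.natAbs_odd, ← Int.not_even_iff_odd]
      intro h
      obtain ⟨k, rfl⟩ := h.two_dvd
      have := ha 2 ⟨k, by ring⟩
      norm_num [Int.isUnit_iff] at this
    rcases Int.natAbs_eq c with h | h
    · exact ⟨2, by decide, c.natAbs, ho, hc, by rw [← h]⟩
    · exact ⟨-2, by decide, c.natAbs, ho, hc, by omega⟩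
  · have hc : Squarefree a.natAbs := Int.squarefree_natAbs.2 ha
    rcases Int.natAbs_eq a with h' | h'
    · exact ⟨1, by decide, a.natAbs, Int.natAbs_odd.2 h, hc, by omega⟩
    · exact ⟨-1, by decide, a.natAbs, Int.natAbs_odd.2 h, hc, by omega⟩

/-- Hilbert reciprocity: two nonzero squarefree integers, with trivial Hilbert symbols at all
places other than a prime `q` dividing exactly one of them, have trivial symbol at `q`. -/
lemma jacobiSym_ne_neg_one_of_local {a b : ℤ} (ha : Squarefree a) (hb : Squarefree b) {q : ℕ}
    (hq : q.Prime) (hqa : ¬(q : ℤ) ∣ a) (hqb : (q : ℤ) ∣ b) (hq2 : q ≠ 2)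
    (hneg : ¬(a < 0 ∧ b < 0)) (hH : HilbertTwo a b)
    (hleft : ∀ p : ℕ, p.Prime → p ≠ 2 → p ≠ q → (p : ℤ) ∣ a → ¬(p : ℤ) ∣ b → J(b | p) = 1)
    (hright : ∀ p : ℕ, p.Prime → p ≠ 2 → p ≠ q → ¬(p : ℤ) ∣ a → (p : ℤ) ∣ b → J(a | p) = 1)
    (hboth : ∀ p : ℕ, p.Prime → p ≠ 2 → p ≠ q → ∀ a' b' : ℤ, a = p * a' → b = p * b' →
      J(-(a' * b') | p) = 1) : J(a | q) ≠ -1 := by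
  intro hJ
  obtain ⟨e₁, h₁, M, hMo, hM, rfl⟩ := exists_eq_mul_odd ha
  obtain ⟨e₂, h₂, N, hNo, hN, rfl⟩ := exists_eq_mul_odd hb
  obtain ⟨d, A, B, hd0, hAB, rfl, rfl⟩ := Nat.exists_coprime' (Nat.gcd_pos_of_pos_left N hMo.pos)
  obtain ⟨hAd, hA, hd⟩ := Nat.squarefree_mul_iff.1 hM
  obtain ⟨hBd, hB, -⟩ := Nat.squarefree_mul_iff.1 hN
  obtain ⟨hAo, hdo⟩ := Nat.odd_mul.1 hMo
  obtain ⟨hBo, -⟩ := Nat.odd_mul.1 hNo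
  have dvd_unit {p : ℕ} (hp : p.Prime) (hp2 : p ≠ 2) {e : ℤ}
      (he : e ∈ ({1, -1, 2, -2} : Finset ℤ)) (n : ℕ) : (p : ℤ) ∣ e * n ↔ p ∣ n := by
    have hpe : ¬(p : ℤ) ∣ e := by
      intro h
      apply hp2
      have h2 : (p : ℤ) ∣ (2 : ℕ) := h.trans (by
        simp only [Finset.mem_insert, Finset.mem_singleton] at he
        rcases he with rfl | rfl | rfl | rfl <;> norm_num)
      exact (Nat.prime_dvd_prime_iff_eq hp Nat.prime_two).1 (Int.natCast_dvd_natCast.1 h2)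
    rw [(Nat.prime_iff_prime_int.1 hp).dvd_mul, or_iff_right hpe, Int.natCast_dvd_natCast]
  have ne_two {p n : ℕ} (hn : Odd n) (h : p ∣ n) : p ≠ 2 := by
    rintro rfl
    exact Nat.not_even_iff_odd.2 hn (even_iff_two_dvd.2 h)
  have not_dvd {p m n : ℕ} (hp : p.Prime) (h : m.Coprime n) (hm : p ∣ m) : ¬p ∣ n :=
    fun hn ↦ Nat.not_coprime_of_dvd_of_dvd hp.one_lt hm hn h
  rw [dvd_unit hq hq2 h₁, hq.dvd_mul, not_or] at hqa
  rw [dvd_unit hq hq2 h₂, hq.dvd_mul, or_iff_left hqa.2] at hqb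
  have hneg' : ¬(e₁ < 0 ∧ e₂ < 0) := fun h ↦ hneg
    ⟨mul_neg_of_neg_of_pos h.1 (by exact_mod_cast hMo.pos),
      mul_neg_of_neg_of_pos h.2 (by exact_mod_cast hNo.pos)⟩
  have hprod := jacobiSym_mul_eq_one h₁ h₂ hAo hBo hdo hAB hAd hBd hneg' hH
  have hJA : J(e₂ * (B * d : ℕ) | A) = 1 := jacobiSym_eq_one_of_forall_prime fun p hp hpA ↦ by
    have hp2 := ne_two hAo hpA
    refine hleft p hp hp2 ?_ ?_ ?_
    · rintro rfl
      exact hqa.1 hpA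
    · rw [dvd_unit hp hp2 h₁]
      exact hpA.mul_right d
    · rw [dvd_unit hp hp2 h₂, hp.dvd_mul, not_or]
      exact ⟨not_dvd hp hAB hpA, not_dvd hp hAd hpA⟩
  have hJd : J(-(e₁ * A * (e₂ * B)) | d) = 1 := jacobiSym_eq_one_of_forall_prime fun p hp hpd ↦ by
    have hp2 := ne_two hdo hpd
    obtain ⟨k, rfl⟩ := hpd
    have := hboth p hp hp2 ?_ (e₁ * A * k) (e₂ * B * k) (by push_cast; ring) (by push_cast; ring)
    · have hk : ¬p ∣ k := not_dvd hp (Nat.squarefree_mul_iff.1 hd).1 dvd_rfl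
      have hk1 : J((k : ℤ) | p) ^ 2 = 1 :=
        jacobiSym.sq_one (by simpa using ((Nat.Prime.coprime_iff_not_dvd hp).2 hk).symm)
      rw [show -(e₁ * A * k * (e₂ * B * k)) = -(e₁ * A * (e₂ * B)) * (k : ℤ) ^ 2 by ring,
        jacobiSym.mul_left, jacobiSym.pow_left, hk1, mul_one] at this
      exact this
    · rintro rfl
      exact hqa.2 (dvd_mul_right _ _)
  have hJB : J(e₁ * (A * d : ℕ) | B) = -1 := by
    obtain ⟨B, rfl⟩ := hqb
    have hqB : ¬q ∣ B := not_dvd hq (Nat.squarefree_mul_iff.1 hB).1 dvd_rfl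
    rw [jacobiSym.mul_right' _ hq.ne_zero (by rintro rfl; simp at hqB), hJ,
      jacobiSym_eq_one_of_forall_prime, mul_one]
    intro p hp hpB
    have hpB' : p ∣ q * B := hpB.mul_left q
    have hp2 := ne_two hBo hpB'
    refine hright p hp hp2 ?_ ?_ ?_
    · rintro rfl
      exact hqB hpB
    · rw [dvd_unit hp hp2 h₁, hp.dvd_mul, not_or]
      exact ⟨not_dvd hp hAB.symm hpB', not_dvd hp hBd hpB'⟩
    · rw [dvd_unit hp hp2 h₂]
      exact hpB'.mul_right d
  rw [hJA, hJB, hJd] at hprod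
  norm_num at hprod

lemma Int.exists_squarefree_mul_sq {M : ℤ} (hM : M ≠ 0) :
    ∃ a f : ℤ, Squarefree a ∧ f ≠ 0 ∧ a * f ^ 2 = M := by
  obtain ⟨a, f, h, ha⟩ := Nat.sq_mul_squarefree M.natAbs
  have hf : (f : ℤ) ≠ 0 := by
    rintro h0
    rw [Nat.cast_eq_zero.1 h0] at h
    apply hM
    simpa using h.symm
  have h' : (f : ℤ) ^ 2 * a = M.natAbs := by exact_mod_cast h
  rcases Int.natAbs_eq M with h1 | h1
  · exact ⟨a, f, Int.squarefree_natCast.2 ha, hf, by linarith⟩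
  · exact ⟨-a, f, Int.squarefree_natAbs.1 (by simpa using ha), hf, by linarith⟩

/-- The integral form of the Brauer–Manin obstruction: in homogeneous coordinates `x = m / n` and
`u = r / s`, there is no rational point with `(x, u)` close to `(17, 5)`. -/
lemma not_sq_of_five_dvd {m n r s W : ℤ} (hmn : IsCoprime m n) (hrs : IsCoprime r s)
    (h1 : (5 : ℤ) ∣ m - 17 * n) (h2 : (25 : ℤ) ∣ r - 5 * s) :
    m * n * ((m - n) * (m - 25 * n)) * (r * s * ((r + 25 * s) * (r + 36 * s))) ≠ W ^ 2 := by
  intro hW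
  have h5 : Prime (5 : ℤ) := by exact_mod_cast Nat.prime_iff_prime_int.1 Nat.prime_five
  have hn : ¬(5 : ℤ) ∣ n := fun hn ↦ not_dvd_of_isCoprime h5 hmn.symm hn (by omega)
  have hs : ¬(5 : ℤ) ∣ s := fun hs ↦ not_dvd_of_isCoprime h5 hrs.symm hs (by omega)
  have hm0 : ¬(5 : ℤ) ∣ m := by omega
  have hmn0 : m * n ≠ 0 := mul_ne_zero (by omega) (by omega)
  have hrs0 : r * s ≠ 0 := mul_ne_zero (by omega) (by omega)
  obtain ⟨a, f, ha, hf0, hf⟩ := Int.exists_squarefree_mul_sq hmn0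
  obtain ⟨b, g, hb, hg0, hg⟩ := Int.exists_squarefree_mul_sq (neg_ne_zero.2 hrs0)
  have hCD : (m - n) * (m - 25 * n) * ((r + 25 * s) * (r + 36 * s)) ≠ 0 :=
    mul_ne_zero (mul_ne_zero (by omega) (by omega)) (mul_ne_zero (by omega) (by omega))
  obtain ⟨w, rfl⟩ : f * g ∣ W := by
    have hg' : r * s = -(b * g ^ 2) := by linarith
    rw [← Int.pow_dvd_pow_iff two_ne_zero, ← hW, ← hf, hg']
    exact ⟨-(a * b * ((m - n) * (m - 25 * n)) * ((r + 25 * s) * (r + 36 * s))), by ring⟩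
  have h : a * b * ((m - n) * (m - 25 * n)) * ((r + 25 * s) * (r + 36 * s)) = -w ^ 2 := by
    apply mul_left_cancel₀ (pow_ne_zero 2 (mul_ne_zero hf0 hg0))
    rw [← hf, show r * s = -(b * g ^ 2) by linarith] at hW
    linear_combination -hW
  have hw : w ≠ 0 := by
    rintro rfl
    have : a * b ≠ 0 := mul_ne_zero ha.ne_zero hb.ne_zero
    apply mul_ne_zero this hCD
    linear_combination h
  have hp2 {p : ℕ} (hp : p.Prime) (h : p ≠ 2) : ¬(p : ℤ) ∣ 2 := fun hd ↦
    h ((Nat.prime_dvd_prime_iff_eq hp Nat.prime_two).1 (by exact_mod_cast hd))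
  have hp5 {p : ℕ} (hp : p.Prime) (h : p ≠ 5) : ¬(p : ℤ) ∣ 5 := fun hd ↦
    h ((Nat.prime_dvd_prime_iff_eq hp Nat.prime_five).1 (by exact_mod_cast hd))
  have ha5 : ¬(5 : ℤ) ∣ a := by
    intro hd
    have : (5 : ℤ) ∣ m * n := hf ▸ hd.mul_right _
    rw [h5.dvd_mul] at this
    tauto
  have hb5 : (5 : ℤ) ∣ b := by
    obtain ⟨k, rfl⟩ : (5 : ℤ) ∣ r := by omega
    have hd : (5 : ℤ) ∣ b * g ^ 2 := ⟨-(k * s), by linarith⟩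
    refine (h5.dvd_mul.1 hd).resolve_right fun hg5 ↦ ?_
    obtain ⟨l, rfl⟩ := h5.dvd_of_dvd_pow hg5
    have : (5 : ℤ) ∣ k * s := ⟨-(b * l ^ 2), by linarith⟩
    rw [h5.dvd_mul] at this
    omega
  refine jacobiSym_ne_neg_one_of_local ha hb Nat.prime_five ha5 hb5 (by norm_num) ?_
    (hilbertTwo_of_eq ha hb hmn hrs hf hg h hw) ?_ ?_ ?_ ?_
  · rintro ⟨ha0, hb0⟩
    have hmn1 : m * n ≤ 0 := hf ▸ mul_nonpos_of_nonpos_of_nonneg ha0.le (sq_nonneg f)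
    have hrs1 : -(r * s) ≤ 0 := hg ▸ mul_nonpos_of_nonpos_of_nonneg hb0.le (sq_nonneg g)
    have hC : 0 ≤ (m - n) * (m - 25 * n) := by nlinarith [sq_nonneg (m - 5 * n)]
    have hD : 0 ≤ (r + 25 * s) * (r + 36 * s) := by nlinarith [sq_nonneg (r - 30 * s)]
    have := mul_nonneg (mul_nonneg (mul_pos_of_neg_of_neg ha0 hb0).le hC) hD
    rw [h] at this
    have := sq_pos_of_ne_zero hw
    omega
  · intro p hp h2 h5 hpa hpb
    have : Fact p.Prime := ⟨hp⟩
    exact jacobiSym_eq_one_of_dvd_left (hp2 hp h2) (hp5 hp h5) ha hmn hrs hf hg h hpa hpb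
  · intro p hp h2 h5 hpa hpb
    have : Fact p.Prime := ⟨hp⟩
    exact jacobiSym_eq_one_of_dvd_right (hp2 hp h2) (hp5 hp h5) hb hmn hrs hf hg h hpa hpb
  · rintro p hp h2 h5 a b rfl rfl
    have : Fact p.Prime := ⟨hp⟩
    exact jacobiSym_eq_one_of_dvd_both (hp2 hp h2) (hp5 hp h5) ha hb hmn hrs hf hg h
  · have h17 : J(a * f ^ 2 | 5) = J(2 * n ^ 2 | 5) := by
      rw [hf]
      refine jacobiSym.mod_left' (Int.modEq_iff_dvd.2 ?_ : m * n % (5 : ℕ) = _)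
      obtain ⟨k, hk⟩ := h1
      exact ⟨-n * (k + 3 * n), by push_cast; linear_combination -n * hk⟩
    have hn1 : J(n | 5) ^ 2 = 1 := jacobiSym.sq_one (by
      rw [← Int.isCoprime_iff_gcd_eq_one, isCoprime_comm]
      exact h5.coprime_iff_not_dvd.2 hn)
    have h25 : J(2 | 5) = -1 := by
      rw [jacobiSym.at_two (by decide)]
      decide
    rw [jacobiSym.mul_left, jacobiSym.pow_left, jacobiSym.mul_left, jacobiSym.pow_left, hn1,
      h25] at h17
    rcases jacobiSym.trichotomy f 5 with h0 | h0 | h0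
    · simp [h0] at h17
    · simpa [h0] using h17
    · simpa [h0] using h17

lemma not_sq_of_norm_sub_lt {x u z : ℚ} (hx : ‖(x : ℚ_[5]) - 17‖ < 1)
    (hu : ‖(u : ℚ_[5]) - 5‖ < 1 / 25) :
    z ^ 2 ≠ x * (x - 1) * (x - 25) * (u * (u + 25) * (u + 36)) := by
  intro hz
  have hcop (q : ℚ) : IsCoprime q.num (q.den : ℤ) := Rat.isCoprime_num_den q
  have hnorm (q : ℚ) (k : ℤ) : ‖((q.num - k * q.den : ℤ) : ℚ_[5])‖ ≤ ‖(q : ℚ_[5]) - k‖ := by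
    have : ((q.num - k * q.den : ℤ) : ℚ_[5]) = ((q : ℚ_[5]) - k) * ((q.den : ℤ) : ℚ_[5]) := by
      have hq : (q : ℚ_[5]) * (q.den : ℚ_[5]) = q.num := by
        exact_mod_cast congrArg (Rat.cast : ℚ → ℚ_[5]) (Rat.mul_den_eq_num q)
      push_cast
      rw [sub_mul, hq]
    rw [this, norm_mul]
    exact mul_le_of_le_one_right (norm_nonneg _) (Padic.norm_int_le_one _)
  have h1 : (5 : ℤ) ∣ x.num - 17 * x.den :=
    Padic.norm_intCast_lt_one_iff.1 ((hnorm x 17).trans_lt (by exact_mod_cast hx))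
  have h2 : (25 : ℤ) ∣ u.num - 5 * u.den := by
    have := (Padic.norm_int_le_pow_iff_dvd (p := 5) (u.num - 5 * u.den) 2).1
      ((hnorm u 5).trans (by norm_num; norm_num at hu; exact hu.le))
    norm_num at this
    exact this
  have hsq : IsSquare (x.num * x.den * ((x.num - x.den) * (x.num - 25 * x.den)) *
      (u.num * u.den * ((u.num + 25 * u.den) * (u.num + 36 * u.den)))) := by
    rw [← Rat.isSquare_intCast_iff]
    refine ⟨z * x.den ^ 2 * u.den ^ 2, ?_⟩
    push_cast
    have hx' : (x.num : ℚ) = x * x.den := (Rat.mul_den_eq_num x).symm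
    have hu' : (u.num : ℚ) = u * u.den := (Rat.mul_den_eq_num u).symm
    rw [hx', hu']
    linear_combination -(x.den : ℚ) ^ 4 * (u.den : ℚ) ^ 4 * hz
  obtain ⟨W, hW⟩ := hsq
  exact not_sq_of_five_dvd (hcop x) (hcop u) h1 h2 (hW.trans (sq W).symm)

lemma exists_sq_eq_padic : ∃ t : ℚ_[5], t ^ 2 = -535296 := by
  have h0 : ‖((535300 : ℤ) : ℤ_[5])‖ < 1 :=
    (PadicInt.norm_int_lt_one_iff_dvd _).2 (by norm_num)
  have h1 : ‖((4 : ℕ) : ℤ_[5])‖ = 1 := PadicInt.norm_natCast_eq_one_iff.2 (by norm_num)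
  obtain ⟨t, ht, -⟩ := hensels_lemma (p := 5)
    (F := (Polynomial.X ^ 2 + Polynomial.C 535296 : Polynomial ℤ_[5])) (a := 2) (by
      have e0 : (2 : ℤ_[5]) ^ 2 + 535296 = (535300 : ℤ) := by norm_num
      have e1 : (2 : ℤ_[5]) * 2 = (4 : ℕ) := by norm_num
      simp only [Polynomial.coe_aeval_eq_eval, Polynomial.eval_add, Polynomial.eval_pow,
        Polynomial.eval_X, Polynomial.eval_C, Polynomial.derivative_add,
        Polynomial.derivative_X_sq, Polynomial.derivative_C, add_zero, Polynomial.eval_mul]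
      rw [e0, e1, h1, one_pow]
      exact h0)
  simp only [Polynomial.coe_aeval_eq_eval, Polynomial.eval_add, Polynomial.eval_pow,
    Polynomial.eval_X, Polynomial.eval_C] at ht
  refine ⟨t, ?_⟩
  have := congrArg (fun y : ℤ_[5] ↦ (y : ℚ_[5])) ht
  push_cast at this
  exact eq_neg_of_add_eq_zero_left this

theorem stmt16
    (V : Set (ℚ_[5] × ℚ_[5] × ℚ_[5]))
    (hV : V = {P | P.2.2 ^ 2 =
      P.1 * (P.1 - 1) * (P.1 - 25) * (P.2.1 * (P.2.1 + 25) * (P.2.1 + 36))})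
    (R : Set (ℚ_[5] × ℚ_[5] × ℚ_[5]))
    (hR : R = {P ∈ V | ∃ x u z : ℚ, P = ((x : ℚ_[5]), (u : ℚ_[5]), (z : ℚ_[5]))}) :
    ¬(V ⊆ closure R) := by
  intro hVR
  obtain ⟨t, ht⟩ := exists_sq_eq_padic
  have hmem : ((17, 5, 5 * t) : ℚ_[5] × ℚ_[5] × ℚ_[5]) ∈ V := by
    rw [hV, Set.mem_ofPred_eq]
    linear_combination 25 * ht
  obtain ⟨P, hP, hdist⟩ := Metric.mem_closure_iff.1 (hVR hmem) (1 / 25) (by norm_num)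
  rw [hR] at hP
  obtain ⟨hPV, x, u, z, rfl⟩ := hP
  rw [hV, Set.mem_ofPred_eq] at hPV
  simp only [Prod.dist_eq, max_lt_iff] at hdist
  obtain ⟨hx, hu, -⟩ := hdist
  rw [dist_comm, dist_eq_norm] at hx hu
  dsimp only at hPV
  refine not_sq_of_norm_sub_lt (hx.trans (by norm_num)) hu (z := z) ?_
  exact_mod_cast hPV
end
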